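/- arXiv:1703.10840 — 2 statements merged into one kernel-verified Lean document; each statement's English description precedes it below -/
import Mathlib

section
/- Let Δ_n(d_tw) denote the maximum of d_tw(T1,T2) over all pairs of unrooted binary phylogenetic trees T1, T2 on a common label set of n taxa. Then Δ_n(d_tw) = Θ(n) for n ≥ 4; that is, there exist constants c_1, c_2 > 0 such that for all n ≥ 4, c_1·n ≤ Δ_n(d_tw) ≤ c_2·n. In particular, Δ_n(d_tw) ≤ n − 3 − ⌊(√(n−2) − 1)/2⌋. -/
open SimpleGraph

/-- `G` has a tree decomposition of width at most `k`: a tree `t` together with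
bags satisfying (tw1), (tw2) and (tw3), all of whose bags have size at most `k+1`. -/
def HasTreeDecompWidthLE {V : Type*} (G : SimpleGraph V) (k : ℕ) : Prop :=
  ∃ (n : ℕ) (t : SimpleGraph (Fin (n + 1))) (bag : Fin (n + 1) → Finset V),
    t.IsTree ∧
    (∀ v : V, ∃ i, v ∈ bag i) ∧
    (∀ u v : V, G.Adj u v → ∃ i, u ∈ bag i ∧ v ∈ bag i) ∧
    (∀ v : V, (t.induce {i | v ∈ bag i}).Connected) ∧
    (∀ i, (bag i).card ≤ k + 1)

/-- The treewidth of a graph: the least `k` such that `G` has a tree decomposition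
of width `k`. -/
noncomputable def treewidth {V : Type*} (G : SimpleGraph V) : ℕ :=
  sInf {k | HasTreeDecompWidthLE G k}

/-- An unrooted binary phylogenetic graph (tree or network) on label set `X`:
a finite connected graph whose degree-1 vertices are bijectively labelled by `X`
and all of whose other vertices have degree 3. -/
structure PhyloGraph (V : Type*) (X : Type*) where
  graph : SimpleGraph V
  finite : Finite V
  connected : graph.Connected
  leaf : X → V
  leaf_inj : Function.Injective leaf
  leaf_deg : ∀ x : X, (graph.neighborSet (leaf x)).ncard = 1
  internal_deg : ∀ v : V, (∀ x : X, leaf x ≠ v) → (graph.neighborSet v).ncard = 3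

/-- An unrooted binary phylogenetic tree on label set `X`. -/
structure PhyloTree (V : Type*) (X : Type*) extends PhyloGraph V X where
  acyclic : graph.IsAcyclic

open Classical in
/-- The map identifying a leaf of the second graph with the leaf of the first
graph carrying the same label. -/
noncomputable def mergeMap {V1 V2 X : Type*} (l1 : X → V1) (l2 : X → V2) :
    V1 ⊕ V2 → V1 ⊕ V2
  | Sum.inl v => Sum.inl v
  | Sum.inr w => if h : ∃ x, l2 x = w then Sum.inl (l1 h.choose) else Sum.inr w

lemma mergeMap_idem {V1 V2 X : Type*} (l1 : X → V1) (l2 : X → V2) (u : V1 ⊕ V2) :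
    mergeMap l1 l2 (mergeMap l1 l2 u) = mergeMap l1 l2 u := by
  classical
  cases u with
  | inl v => rfl
  | inr w =>
    by_cases h : ∃ x, l2 x = w
    · simp [mergeMap, h]
    · simp [mergeMap, h]

/-- The vertex set of the display graph: the disjoint union of the vertex sets
of the two graphs, with leaves carrying the same label identified. -/
def DisplayVertex {V1 V2 X : Type*} (l1 : X → V1) (l2 : X → V2) : Type _ :=
  {u : V1 ⊕ V2 // mergeMap l1 l2 u = u}

/-- The canonical map from `V1 ⊕ V2` to the vertex set of the display graph. -/
noncomputable def toDisplay {V1 V2 X : Type*} (l1 : X → V1) (l2 : X → V2) (u : V1 ⊕ V2) :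
    DisplayVertex l1 l2 :=
  ⟨mergeMap l1 l2 u, mergeMap_idem l1 l2 u⟩

/-- The display graph of two leaf-labelled graphs: their disjoint union with the
leaves carrying the same label identified. -/
noncomputable def displayGraph {V1 V2 X : Type*} (G1 : SimpleGraph V1) (l1 : X → V1)
    (G2 : SimpleGraph V2) (l2 : X → V2) : SimpleGraph (DisplayVertex l1 l2) :=
  SimpleGraph.fromRel (fun a b =>
    (∃ u v : V1, G1.Adj u v ∧ a = toDisplay l1 l2 (Sum.inl u) ∧ b = toDisplay l1 l2 (Sum.inl v)) ∨
    (∃ u v : V2, G2.Adj u v ∧ a = toDisplay l1 l2 (Sum.inr u) ∧ b = toDisplay l1 l2 (Sum.inr v)))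

/-- The treewidth distance between two phylogenetic trees:
`d_tw(T1,T2) = tw(D(T1,T2)) - 2`. -/
noncomputable def dtw {V1 V2 X : Type*} (T1 : PhyloTree V1 X) (T2 : PhyloTree V2 X) : ℕ :=
  treewidth (displayGraph T1.graph T1.leaf T2.graph T2.leaf) - 2

/-- Two phylogenetic trees are compatible if there is a label-preserving
isomorphism between them. -/
def Compatible {V1 V2 X : Type*} (T1 : PhyloTree V1 X) (T2 : PhyloTree V2 X) : Prop :=
  ∃ φ : T1.graph ≃g T2.graph, ∀ x : X, φ (T1.leaf x) = T2.leaf x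

/-- The diameter `Δ_n(d_tw)`: the maximum treewidth distance over all pairs of
unrooted binary phylogenetic trees on a common label set of `n` taxa. -/
noncomputable def DeltaTW (n : ℕ) : ℕ :=
  sSup {k | ∃ (X V1 V2 : Type) (T1 : PhyloTree V1 X) (T2 : PhyloTree V2 X),
    Nat.card X = n ∧ dtw T1 T2 = k}


open SimpleGraph
namespace DTW

/-- Restrict a graph to a set of vertices, keeping the vertex type. -/
def restr {V : Type*} (G : SimpleGraph V) (S : Set V) : SimpleGraph V where
  Adj u v := G.Adj u v ∧ u ∈ S ∧ v ∈ S
  symm := ⟨fun _ _ h => ⟨h.1.symm, h.2.2, h.2.1⟩⟩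
  loopless := ⟨fun _ h => h.1.ne rfl⟩

/-- `S` is connected (or empty) in `G`. -/
def Conn {V : Type*} (G : SimpleGraph V) (S : Set V) : Prop :=
  ∀ a ∈ S, ∀ b ∈ S, (restr G S).Reachable a b

lemma restr_mono {V : Type*} (G : SimpleGraph V) {S T : Set V} (h : S ⊆ T) :
    restr G S ≤ restr G T := by
  intro u v huv
  exact ⟨huv.1, h huv.2.1, h huv.2.2⟩

lemma conn_of_induce {V : Type*} (G : SimpleGraph V) (S : Set V)
    (h : (G.induce S).Connected) : Conn G S := by
  intro a ha b hb
  have := h.preconnected ⟨a, ha⟩ ⟨b, hb⟩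
  exact this.map (⟨Subtype.val, fun {x y} hxy => ⟨hxy, x.2, y.2⟩⟩ : G.induce S →g restr G S)

lemma restr_mem_of_reachable {V : Type*} (G : SimpleGraph V) (S : Set V) {a b : V}
    (ha : a ∈ S) (h : (restr G S).Reachable a b) : b ∈ S := by
  obtain ⟨p⟩ := h
  induction p with
  | nil => exact ha
  | cons h _ ih => exact ih h.2.2

/-- A Helly type statement: no assignment of avoiding connected pairwise intersecting sets. -/
theorem helly {ι : Type*} [Finite ι] (t : SimpleGraph ι) (ht : t.IsTree) (N : ι → Set ι)
    (hne : ∀ i, (N i).Nonempty) (hi : ∀ i, i ∉ N i) (hc : ∀ i, Conn t (N i))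
    (hint : ∀ i j, (N i ∩ N j).Nonempty) : False := by
  classical
  have : Nonempty ι := ht.connected.nonempty
  let K : ι → Set ι := fun i => {a | ∃ n ∈ N i, (restr t {i}ᶜ).Reachable n a}
  have hsub : ∀ i, N i ⊆ {i}ᶜ := fun i a ha h => hi i (h ▸ ha)
  have hNK : ∀ i, N i ⊆ K i := fun i a ha => ⟨a, ha, Reachable.refl _⟩
  have hK : ∀ i, ∀ a ∈ K i, ∀ b ∈ K i, (restr t {i}ᶜ).Reachable a b := by
    rintro i a ⟨n, hn, hna⟩ b ⟨m, hm, hmb⟩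
    exact hna.symm.trans (((hc i n hn m hm).mono (restr_mono t (hsub i))).trans hmb)
  have hKi : ∀ i, i ∉ K i := by
    rintro i ⟨n, hn, h⟩
    exact restr_mem_of_reachable t {i}ᶜ (hsub i hn) h rfl
  obtain ⟨i, hmin⟩ := Finite.exists_min (fun i => (K i).ncard)
  obtain ⟨n, hn⟩ := hne i
  obtain ⟨p⟩ := ht.connected.preconnected n i
  obtain ⟨d, -, hd1, hd2⟩ := p.exists_boundary_dart (K i) (hNK i hn) (hKi i)
  have hd : d.snd = i := by
    by_contra h
    apply hd2
    have hd0 := hd1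
    obtain ⟨m, hm, hr⟩ := hd1
    refine ⟨m, hm, hr.trans ?_⟩
    refine Adj.reachable ⟨d.adj, ?_, h⟩
    intro h'
    exact hKi i ((show d.fst = i from h') ▸ hd0)
  have hadj : t.Adj d.fst i := hd ▸ d.adj
  generalize d.fst = j at hd1 hadj
  obtain ⟨k, hk1, hk2⟩ := hint i j
  by_cases hij : i ∈ K j
  · have h1 := hK i j hd1 k (hNK i hk1)
    have h2 := hK j i hij k (hNK j hk2)
    have hb := (isAcyclic_iff_forall_adj_isBridge.mp ht.isAcyclic) hadj
    rw [isBridge_iff] at hb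
    apply hb
    refine (h1.mono ?_).trans (h2.mono ?_).symm
    · intro u v huv
      rw [deleteEdges_adj]
      refine ⟨huv.1, ?_⟩
      have e1 : u ≠ i := huv.2.1
      have e2 : v ≠ i := huv.2.2
      simp [e1, e2]
    · intro u v huv
      rw [deleteEdges_adj]
      refine ⟨huv.1, ?_⟩
      have e1 : u ≠ j := huv.2.1
      have e2 : v ≠ j := huv.2.2
      simp [e1, e2]
  · have key : ∀ a, (restr t {j}ᶜ).Reachable k a → a ∈ K i := by
      intro a ⟨q⟩
      by_contra hak
      obtain ⟨d, hdq, hd1, hd2⟩ := q.exists_boundary_dart (K i ∩ K j)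
        ⟨hNK i hk1, hNK j hk2⟩ (fun h => hak h.1)
      have h2 : d.snd ∈ K j := by
        obtain ⟨m, hm, hr⟩ := hd1.2
        exact ⟨m, hm, hr.trans d.adj.reachable⟩
      apply hd2
      refine ⟨?_, h2⟩
      obtain ⟨m, hm, hr⟩ := hd1.1
      refine ⟨m, hm, hr.trans (Adj.reachable ⟨d.adj.1, ?_, ?_⟩)⟩
      · intro h; exact hij ((show d.fst = i from h) ▸ hd1.2)
      · intro h; exact hij ((show d.snd = i from h) ▸ h2)
    have hlt : (K j).ncard < (K i).ncard := by
      apply Set.ncard_lt_ncard _ (Set.toFinite _)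
      refine ⟨fun a ha => key a (hK j k (hNK j hk2) a ha), fun h => hKi j (h hd1)⟩
    exact absurd (hmin j) (not_le.mpr hlt)

/-- Nodes of a tree decomposition meeting a connected set form a connected set. -/
lemma nodes_conn {V ι : Type*} (G : SimpleGraph V) (t : SimpleGraph ι) (bag : ι → Finset V)
    (h2 : ∀ u v : V, G.Adj u v → ∃ i, u ∈ bag i ∧ v ∈ bag i)
    (h3 : ∀ v : V, (t.induce {i | v ∈ bag i}).Connected)
    (S : Set V) (hS : Conn G S) : Conn t {i | ∃ v ∈ S, v ∈ bag i} := by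
  have hsame : ∀ v ∈ S, ∀ a b, v ∈ bag a → v ∈ bag b →
      (restr t {i | ∃ v ∈ S, v ∈ bag i}).Reachable a b := by
    intro v hv a b ha hb
    refine (conn_of_induce t _ (h3 v) a ha b hb).mono (restr_mono t ?_)
    intro i hi
    exact ⟨v, hv, hi⟩
  rintro a ⟨u, hu, hua⟩ b ⟨v, hv, hvb⟩
  obtain ⟨p⟩ := hS u hu v hv
  clear hu
  induction p generalizing a with
  | nil => exact hsame _ hv a b hua hvb
  | cons h q ih =>
    obtain ⟨c, hc1, hc2⟩ := h2 _ _ h.1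
    exact (hsame _ h.2.1 a c hua hc1).trans (ih c hc2 hv hvb)

end DTW


open SimpleGraph
namespace DTW

/-- A graph given by a parent function with decreasing rank is a tree. -/
lemma parent_tree {N : Type*} [Finite N] (t : SimpleGraph N) (root : N) (p : N → N) (r : N → ℕ)
    (hroot : p root = root) (hr : ∀ v, v ≠ root → r (p v) < r v)
    (hadj : ∀ u v, t.Adj u v ↔ u ≠ v ∧ (p u = v ∨ p v = u)) : t.IsTree := by
  classical
  have := Fintype.ofFinite N
  have hreach : ∀ k, ∀ v, r v = k → t.Reachable v root := by
    intro k
    induction k using Nat.strong_induction_on with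
    | _ k ih =>
      intro v hv
      by_cases h : v = root
      · rw [h]
      · have h1 := hr v h
        have h2 : t.Adj v (p v) := by
          rw [hadj]
          refine ⟨fun h' => ?_, Or.inl rfl⟩
          rw [← h'] at h1
          exact lt_irrefl _ h1
        exact h2.reachable.trans (ih _ (hv ▸ h1) _ rfl)
  have hconn : t.Connected := by
    rw [connected_iff]
    exact ⟨fun a b => (hreach _ a rfl).trans (hreach _ b rfl).symm, ⟨root⟩⟩
  rw [isTree_iff_connected_and_card]
  refine ⟨hconn, le_antisymm ?_ hconn.card_vert_le_card_edgeSet_add_one⟩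
  have hsub : t.edgeSet ⊆ ((Finset.univ.erase root).image (fun v => s(v, p v)) : Finset (Sym2 N)) := by
    intro e
    induction e with
    | _ u v =>
      intro h
      rw [mem_edgeSet, hadj] at h
      simp only [Finset.coe_image, Set.mem_image]
      rcases h with ⟨hne, h | h⟩
      · refine ⟨u, ?_, by rw [h]⟩
        simp only [Finset.coe_erase, Finset.coe_univ, Set.mem_sdiff, Set.mem_univ,
          Set.mem_singleton_iff, true_and]
        rintro rfl
        exact hne (hroot ▸ h)
      · refine ⟨v, ?_, by rw [h, Sym2.eq_swap]⟩
        simp only [Finset.coe_erase, Finset.coe_univ, Set.mem_sdiff, Set.mem_univ,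
          Set.mem_singleton_iff, true_and]
        rintro rfl
        exact hne.symm (hroot ▸ h)
  have h1 := Set.ncard_le_ncard hsub (Set.toFinite _)
  rw [Set.ncard_coe_finset] at h1
  have h2 := h1.trans Finset.card_image_le
  rw [Finset.card_erase_of_mem (Finset.mem_univ _), Finset.card_univ, ← Nat.card_eq_fintype_card] at h2
  have h3 : 0 < Nat.card N := Nat.card_pos_iff.mpr ⟨⟨root⟩, inferInstance⟩
  rw [Set.ncard_def, Set.encard] at h2
  change Nat.card t.edgeSet ≤ _ at h2
  omega

/-- Tree decompositions may be indexed by any finite type. -/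
lemma mk_td {V ι : Type*} [Finite ι] (G : SimpleGraph V) (k : ℕ) (t : SimpleGraph ι)
    (bag : ι → Finset V) (ht : t.IsTree) (h1 : ∀ v : V, ∃ i, v ∈ bag i)
    (h2 : ∀ u v : V, G.Adj u v → ∃ i, u ∈ bag i ∧ v ∈ bag i)
    (h3 : ∀ v : V, (t.induce {i | v ∈ bag i}).Connected)
    (h4 : ∀ i, (bag i).card ≤ k + 1) : HasTreeDecompWidthLE G k := by
  have := Fintype.ofFinite ι
  have hne : Nonempty ι := ht.connected.nonempty
  obtain ⟨n, hn⟩ : ∃ n, Fintype.card ι = n + 1 :=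
    ⟨Fintype.card ι - 1, by have := Fintype.card_pos (α := ι); omega⟩
  let e : Fin (n + 1) ≃ ι := (Fintype.equivFinOfCardEq hn).symm
  refine ⟨n, t.comap e, fun i => bag (e i), ?_, ?_, ?_, ?_, fun i => h4 _⟩
  · exact (Iso.comap e t).isTree_iff.mpr ht
  · intro v
    obtain ⟨i, hi⟩ := h1 v
    exact ⟨e.symm i, by simpa using hi⟩
  · intro u v huv
    obtain ⟨i, hi⟩ := h2 u v huv
    exact ⟨e.symm i, by simpa using hi⟩
  · intro v
    let f : (t.comap e).induce {i | v ∈ bag (e i)} ≃g t.induce {i | v ∈ bag i} :=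
      { toEquiv := e.subtypeEquiv (fun i => Iff.rfl)
        map_rel_iff' := by intro a b; exact Iff.rfl }
    exact f.connected_iff.mpr (h3 v)

/-- If deleting `R` leaves a subgraph of a rooted tree, the treewidth is at most `|R| + 1`. -/
lemma td_of_parent {D : Type*} [Finite D] (G : SimpleGraph D) (R : Finset D)
    (root : {x // x ∉ R}) (p : {x // x ∉ R} → {x // x ∉ R}) (r : {x // x ∉ R} → ℕ)
    (hroot : p root = root) (hr : ∀ v, v ≠ root → r (p v) < r v)
    (hG : ∀ u v : {x // x ∉ R}, G.Adj u v → p u = v ∨ p v = u) :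
    HasTreeDecompWidthLE G (R.card + 1) := by
  classical
  let t : SimpleGraph {x // x ∉ R} :=
    { Adj := fun u v => u ≠ v ∧ (p u = v ∨ p v = u)
      symm := ⟨fun _ _ h => ⟨h.1.symm, h.2.symm⟩⟩
      loopless := ⟨fun _ h => h.1 rfl⟩ }
  have ht : t.IsTree := parent_tree t root p r hroot hr (fun _ _ => Iff.rfl)
  refine mk_td G _ t (fun i => R ∪ {i.1, (p i).1}) ht ?_ ?_ ?_ ?_
  · intro v
    by_cases hv : v ∈ R
    · exact ⟨root, by simp [hv]⟩
    · exact ⟨⟨v, hv⟩, by simp⟩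
  · intro u v huv
    by_cases hu : u ∈ R
    · by_cases hv : v ∈ R
      · exact ⟨root, by simp [hv, hu]⟩
      · exact ⟨⟨v, hv⟩, by simp [hu]⟩
    · by_cases hv : v ∈ R
      · exact ⟨⟨u, hu⟩, by simp [hv]⟩
      · rcases hG ⟨u, hu⟩ ⟨v, hv⟩ huv with h | h
        · exact ⟨⟨u, hu⟩, by simp [h]⟩
        · exact ⟨⟨v, hv⟩, by simp [h]⟩
  · intro v
    by_cases hv : v ∈ R
    · have : {i : {x // x ∉ R} | v ∈ R ∪ {i.1, (p i).1}} = Set.univ := by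
        ext i; simp [hv]
      rw [this]
      exact (induceUnivIso t).connected_iff.mpr ht.connected
    · have hmem : (⟨v, hv⟩ : {x // x ∉ R}) ∈ {i : {x // x ∉ R} | v ∈ R ∪ {i.1, (p i).1}} := by
        simp
      have key : ∀ a : ↥{i : {x // x ∉ R} | v ∈ R ∪ {i.1, (p i).1}},
          (t.induce {i : {x // x ∉ R} | v ∈ R ∪ {i.1, (p i).1}}).Reachable a ⟨⟨v, hv⟩, hmem⟩ := by
        rintro ⟨a, ha⟩
        by_cases hav : a = ⟨v, hv⟩
        · subst hav; exact Reachable.refl _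
        · apply Adj.reachable
          refine ⟨hav, Or.inl ?_⟩
          have ha' : v ∈ R ∪ {a.1, (p a).1} := ha
          simp only [Finset.mem_union, hv, Finset.mem_insert, Finset.mem_singleton, false_or] at ha'
          rcases ha' with h | h
          · exact absurd (Subtype.ext h.symm) hav
          · exact Subtype.ext h.symm
      rw [connected_iff]
      exact ⟨fun a b => (key a).trans (key b).symm, ⟨⟨_, hmem⟩⟩⟩
  · intro i
    refine (Finset.card_union_le _ _).trans ?_
    have := Finset.card_le_two (a := i.1) (b := (p i).1)
    omega

/-- Every finite tree has a parent function. -/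
lemma exists_parent {V : Type*} (G : SimpleGraph V) (hG : G.IsTree) (root : V) :
    ∃ (p : V → V) (r : V → ℕ), p root = root ∧ (∀ v, v ≠ root → r (p v) < r v) ∧
      ∀ u v, G.Adj u v → p u = v ∨ p v = u := by
  classical
  have hex : ∀ v, ∃ w, (v = root → w = root) ∧ (v ≠ root → G.Adj v w ∧ G.dist root w < G.dist root v) := by
    intro v
    by_cases h : v = root
    · exact ⟨root, fun _ => rfl, fun h' => absurd h h'⟩
    · obtain ⟨q, hq⟩ := hG.connected.exists_walk_length_eq_dist v root
      cases q with
      | nil => exact absurd rfl h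
      | cons hadj q =>
        refine ⟨_, fun h' => absurd h' h, fun _ => ⟨hadj, ?_⟩⟩
        have := dist_le q
        rw [Walk.length_cons] at hq
        rw [dist_comm, dist_comm (u := root)]
        omega
  choose p hp1 hp2 using hex
  refine ⟨p, G.dist root, hp1 root rfl, fun v hv => (hp2 v hv).2, ?_⟩
  -- uniqueness of the neighbour closer to the root
  have huniq : ∀ u v, G.Adj u v → G.dist root v < G.dist root u → p u = v := by
    intro u v huv hlt
    have hu : u ≠ root := by
      rintro rfl
      simp at hlt
    obtain ⟨h1, h2⟩ := hp2 u hu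
    have hpath : ∀ w, G.Adj u w → G.dist root w < G.dist root u →
        ∃ q : G.Walk u root, q.IsPath ∧ q.snd = w := by
      intro w huw hw
      obtain ⟨q, hq, hl⟩ := hG.connected.exists_path_of_dist w root
      refine ⟨Walk.cons huw q, ?_, by simp⟩
      rw [Walk.cons_isPath_iff]
      refine ⟨hq, fun hmem => ?_⟩
      have h3 := dist_le (q.dropUntil u hmem)
      have h4 := q.length_dropUntil_le_length hmem
      rw [hl] at h4
      rw [dist_comm (v := w), dist_comm (v := u)] at hw
      omega
    obtain ⟨q1, hq1, e1⟩ := hpath _ h1 h2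
    obtain ⟨q2, hq2, e2⟩ := hpath _ huv hlt
    rw [← e1, ← e2, (hG.existsUnique_path u root).unique hq1 hq2]
  intro u v huv
  rcases lt_trichotomy (G.dist root u) (G.dist root v) with h | h | h
  · exact Or.inr (huniq v u huv.symm h)
  · exact absurd h (hG.dist_ne_of_adj root huv)
  · exact Or.inl (huniq u v huv h)

end DTW


open SimpleGraph
namespace DTW

section display
variable {V1 V2 X : Type*} (T1 : PhyloTree V1 X) (T2 : PhyloTree V2 X)

/-- The display graph of two trees. -/
noncomputable abbrev DG : SimpleGraph (DisplayVertex T1.leaf T2.leaf) :=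
  displayGraph T1.graph T1.leaf T2.graph T2.leaf

/-- Inclusion of the first tree. -/
noncomputable def f1 (v : V1) : DisplayVertex T1.leaf T2.leaf := toDisplay _ _ (Sum.inl v)
/-- Inclusion of the second tree. -/
noncomputable def f2 (v : V2) : DisplayVertex T1.leaf T2.leaf := toDisplay _ _ (Sum.inr v)

lemma f1_val (v : V1) : (f1 T1 T2 v).1 = Sum.inl v := rfl

lemma f2_leaf (x : X) : f2 T1 T2 (T2.leaf x) = f1 T1 T2 (T1.leaf x) := by
  have h : ∃ y, T2.leaf y = T2.leaf x := ⟨x, rfl⟩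
  apply Subtype.ext
  simp only [f1, f2, toDisplay, mergeMap, h, dif_pos]
  rw [T2.leaf_inj h.choose_spec]

lemma f2_val (w : V2) (h : ∀ x, T2.leaf x ≠ w) : (f2 T1 T2 w).1 = Sum.inr w := by
  have h : ¬ ∃ y, T2.leaf y = w := fun ⟨x, hx⟩ => h x hx
  simp [f2, toDisplay, mergeMap, h]

lemma f1_inj : Function.Injective (f1 T1 T2) := by
  intro a b h
  have := congrArg Subtype.val h
  rw [f1_val, f1_val] at this
  exact Sum.inl_injective this

lemma f2_inj : Function.Injective (f2 T1 T2) := by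
  intro a b h
  by_cases ha : ∃ x, T2.leaf x = a
  · obtain ⟨x, rfl⟩ := ha
    by_cases hb : ∃ x, T2.leaf x = b
    · obtain ⟨y, rfl⟩ := hb
      rw [f2_leaf, f2_leaf] at h
      rw [T1.leaf_inj (f1_inj T1 T2 h)]
    · rw [f2_leaf] at h
      have := congrArg Subtype.val h
      rw [f2_val _ _ _ (fun x hx => hb ⟨x, hx⟩), f1_val] at this
      cases this
  · by_cases hb : ∃ x, T2.leaf x = b
    · obtain ⟨y, rfl⟩ := hb
      rw [f2_leaf] at h
      have := congrArg Subtype.val h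
      rw [f2_val _ _ _ (fun x hx => ha ⟨x, hx⟩), f1_val] at this
      cases this
    · have := congrArg Subtype.val h
      rw [f2_val _ _ _ (fun x hx => ha ⟨x, hx⟩), f2_val _ _ _ (fun x hx => hb ⟨x, hx⟩)] at this
      exact Sum.inr_injective this

lemma f1_ne_f2 (v : V1) (w : V2) (h : ∀ x, T2.leaf x ≠ w) : f1 T1 T2 v ≠ f2 T1 T2 w := by
  intro he
  have := congrArg Subtype.val he
  rw [f2_val _ _ _ h, f1_val] at this
  cases this

lemma f1_adj {u v : V1} (h : T1.graph.Adj u v) : (DG T1 T2).Adj (f1 T1 T2 u) (f1 T1 T2 v) := by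
  refine ⟨fun he => h.ne (f1_inj T1 T2 he), Or.inl (Or.inl ⟨u, v, h, rfl, rfl⟩)⟩

lemma f2_adj {u v : V2} (h : T2.graph.Adj u v) : (DG T1 T2).Adj (f2 T1 T2 u) (f2 T1 T2 v) := by
  refine ⟨fun he => h.ne (f2_inj T1 T2 he), Or.inl (Or.inr ⟨u, v, h, rfl, rfl⟩)⟩

lemma dv_cases (x : DisplayVertex T1.leaf T2.leaf) :
    (∃ v, x = f1 T1 T2 v) ∨ ∃ w, (∀ y, T2.leaf y ≠ w) ∧ x = f2 T1 T2 w := by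
  obtain ⟨x, hx⟩ := x
  cases x with
  | inl v => exact Or.inl ⟨v, rfl⟩
  | inr w =>
    right
    by_cases h : ∃ y, T2.leaf y = w
    · simp [mergeMap, h] at hx
    · have h' : ∀ y, T2.leaf y ≠ w := fun y hy => h ⟨y, hy⟩
      exact ⟨w, h', Subtype.ext (f2_val T1 T2 w h').symm⟩

lemma dg_adj {a b : DisplayVertex T1.leaf T2.leaf} (h : (DG T1 T2).Adj a b) :
    (∃ u v, T1.graph.Adj u v ∧ a = f1 T1 T2 u ∧ b = f1 T1 T2 v) ∨
    (∃ u v, T2.graph.Adj u v ∧ a = f2 T1 T2 u ∧ b = f2 T1 T2 v) := by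
  rcases h.2 with (h | h) | (⟨u, v, h, h1, h2⟩ | ⟨u, v, h, h1, h2⟩)
  · exact Or.inl h
  · exact Or.inr h
  · exact Or.inl ⟨v, u, h.symm, h2, h1⟩
  · exact Or.inr ⟨v, u, h.symm, h2, h1⟩

end display

lemma nbr_unique {V X : Type*} (T : PhyloTree V X) (x : X) {u v : V}
    (hu : T.graph.Adj (T.leaf x) u) (hv : T.graph.Adj (T.leaf x) v) : u = v := by
  obtain ⟨a, ha⟩ := Set.ncard_eq_one.mp (T.leaf_deg x)
  have h1 : u ∈ T.graph.neighborSet (T.leaf x) := hu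
  have h2 : v ∈ T.graph.neighborSet (T.leaf x) := hv
  rw [ha] at h1 h2
  exact h1.trans h2.symm

/-- Leaves of a tree with at least four taxa are pairwise nonadjacent. -/
lemma leaf_not_adj {V X : Type*} (T : PhyloTree V X) (hX : 4 ≤ Nat.card X) (x y : X) :
    ¬ T.graph.Adj (T.leaf x) (T.leaf y) := by
  classical
  intro h
  have hall : ∀ v, v = T.leaf x ∨ v = T.leaf y := by
    intro v
    by_contra hv
    obtain ⟨p⟩ := T.connected.preconnected (T.leaf x) v
    obtain ⟨d, -, h1, h2⟩ := p.exists_boundary_dart {w | w = T.leaf x ∨ w = T.leaf y} (Or.inl rfl) hv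
    have hadj := d.adj
    rcases h1 with h1 | h1
    · rw [h1] at hadj
      exact h2 (Or.inr (nbr_unique T x hadj h))
    · rw [h1] at hadj
      exact h2 (Or.inl (nbr_unique T y hadj h.symm))
  have hall' : ∀ z, z = x ∨ z = y := by
    intro z
    rcases hall (T.leaf z) with h | h
    · exact Or.inl (T.leaf_inj h)
    · exact Or.inr (T.leaf_inj h)
  have hu : (Set.univ : Set X) ⊆ {x, y} := fun z _ => hall' z
  have := Set.ncard_le_ncard hu (Set.toFinite _)
  rw [Set.ncard_univ] at this
  have h2 := Set.ncard_insert_le x {y}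
  rw [Set.ncard_singleton] at h2
  omega

lemma exists_K {V X : Type*} [Fintype V] [Fintype X] (T : PhyloTree V X)
    (hX : 4 ≤ Fintype.card X) :
    ∃ I K : Finset V, (∀ v, v ∈ I ↔ ∀ x, T.leaf x ≠ v) ∧ I.card + 2 = Fintype.card X ∧ K ⊆ I ∧
      (∀ k ∈ K, ∀ x y, T.graph.Adj k (T.leaf x) → T.graph.Adj k (T.leaf y) → x = y) ∧
      (∀ k ∈ K, ∀ l ∈ K, ¬ T.graph.Adj k l) ∧
      Fintype.card X ≤ 2 * (2 * K.card + 2) := by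
  classical
  let I : Finset V := Finset.univ.filter (fun v => ∀ x, T.leaf x ≠ v)
  let Lf : Finset V := Finset.univ.image T.leaf
  have hI : ∀ v, v ∈ I ↔ ∀ x, T.leaf x ≠ v := by intro v; simp [I]
  have hLfc : Lf.card = Fintype.card X := by
    rw [Finset.card_image_of_injective _ T.leaf_inj, Finset.card_univ]
  have hcompl : Iᶜ = Lf := by
    ext v; simp [I, Lf]
  have hdeg : ∀ v, T.graph.degree v = (T.graph.neighborSet v).ncard := by
    intro v
    rw [← card_neighborSet_eq_degree, Set.ncard_eq_toFinset_card', Set.toFinset_card]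
  have hVI : I.card + Fintype.card X = Fintype.card V := by
    rw [← hLfc, ← hcompl, Finset.card_add_card_compl]
  have hsum : ∑ v, T.graph.degree v = 3 * I.card + Fintype.card X := by
    rw [← Finset.sum_add_sum_compl I, hcompl]
    have e1 : ∑ v ∈ I, T.graph.degree v = 3 * I.card := by
      rw [Finset.sum_congr rfl (g := fun _ => 3)]
      · simp [mul_comm]
      · intro v hv; rw [hdeg, T.internal_deg v ((hI v).mp hv)]
    have e2 : ∑ v ∈ Lf, T.graph.degree v = Fintype.card X := by
      rw [Finset.sum_congr rfl (g := fun _ => 1)]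
      · simp [hLfc]
      · intro v hv
        obtain ⟨x, -, rfl⟩ := Finset.mem_image.mp hv
        rw [hdeg, T.leaf_deg x]
    rw [e1, e2]
  have htree : T.graph.IsTree := ⟨T.connected, T.acyclic⟩
  have hE := htree.card_edgeFinset
  have hS := T.graph.sum_degrees_eq_twice_card_edges
  have hIc : I.card + 2 = Fintype.card X := by omega
  let C : Finset V := I.filter (fun v => 2 ≤ (T.graph.neighborFinset v ∩ Lf).card)
  have hC : 2 * C.card ≤ Fintype.card X := by
    have hd : ∀ u ∈ C, ∀ v ∈ C, u ≠ v →
        Disjoint (T.graph.neighborFinset u ∩ Lf) (T.graph.neighborFinset v ∩ Lf) := by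
      intro u _ v _ huv
      rw [Finset.disjoint_left]
      intro w hw1 hw2
      simp only [Finset.mem_inter, mem_neighborFinset, Lf, Finset.mem_image] at hw1 hw2
      obtain ⟨hw1, x, -, rfl⟩ := hw1
      exact huv (nbr_unique T x hw1.symm hw2.1.symm)
    have h1 := Finset.card_biUnion hd
    have h2 : (C.biUnion fun u => T.graph.neighborFinset u ∩ Lf).card ≤ Lf.card := by
      apply Finset.card_le_card
      intro w hw
      simp only [Finset.mem_biUnion, Finset.mem_inter] at hw
      obtain ⟨_, _, _, h⟩ := hw
      exact h
    have h3 : ∑ u ∈ C, 2 ≤ ∑ u ∈ C, (T.graph.neighborFinset u ∩ Lf).card :=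
      Finset.sum_le_sum (fun u hu => (Finset.mem_filter.mp hu).2)
    rw [Finset.sum_const, smul_eq_mul] at h3
    omega
  let W := I \ C
  have hW : I.card ≤ W.card + C.card := by
    have := Finset.le_card_sdiff C I
    have : W.card = (I \ C).card := rfl
    omega
  obtain ⟨col⟩ := T.acyclic.colorable_two
  have hsplit : (W.filter (fun v => col v = 0)).card + (W.filter (fun v => ¬ col v = 0)).card = W.card :=
    Finset.card_filter_add_card_filter_not _
  have hW1 : ∀ k ∈ W, ∀ x y, T.graph.Adj k (T.leaf x) → T.graph.Adj k (T.leaf y) → x = y := by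
    intro k hk x y hx hy
    simp only [W, C, Finset.mem_sdiff, Finset.mem_filter, not_and, not_le] at hk
    have h := hk.2 hk.1
    have h' := Finset.card_le_one.mp (Nat.lt_succ_iff.mp h) (T.leaf x) (by simp [hx, Lf])
      (T.leaf y) (by simp [hy, Lf])
    exact T.leaf_inj h'
  have hfin : ∀ K : Finset V, K ⊆ W → (∀ k ∈ K, ∀ l ∈ K, col k = col l) → W.card ≤ 2 * K.card →
      ∃ I K : Finset V, (∀ v, v ∈ I ↔ ∀ x, T.leaf x ≠ v) ∧ I.card + 2 = Fintype.card X ∧ K ⊆ I ∧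
      (∀ k ∈ K, ∀ x y, T.graph.Adj k (T.leaf x) → T.graph.Adj k (T.leaf y) → x = y) ∧
      (∀ k ∈ K, ∀ l ∈ K, ¬ T.graph.Adj k l) ∧
      Fintype.card X ≤ 2 * (2 * K.card + 2) := by
    intro K hK hcol hcard
    refine ⟨I, K, hI, hIc, hK.trans Finset.sdiff_subset, fun k hk => hW1 k (hK hk), ?_, by omega⟩
    intro k hk l hl hadj
    exact col.valid hadj (hcol k hk l hl)
  by_cases hc : W.card ≤ 2 * (W.filter (fun v => col v = 0)).card
  · refine hfin _ (Finset.filter_subset _ _) ?_ hc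
    intro k hk l hl
    rw [(Finset.mem_filter.mp hk).2, (Finset.mem_filter.mp hl).2]
  · refine hfin (W.filter (fun v => ¬ col v = 0)) (Finset.filter_subset _ _) ?_ (by omega)
    intro k hk l hl
    have h1 := (Finset.mem_filter.mp hk).2
    have h2 := (Finset.mem_filter.mp hl).2
    omega

/-- The upper bound on the treewidth of display graphs. -/
theorem td_upper {V1 V2 X : Type*} (T1 : PhyloTree V1 X) (T2 : PhyloTree V2 X)
    (hX : 4 ≤ Nat.card X) :
    ∃ κ : ℕ, κ + 2 ≤ Nat.card X ∧ Nat.card X ≤ 2 * (2 * κ + 2) ∧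
      HasTreeDecompWidthLE (DG T1 T2) (Nat.card X - 1 - κ) := by
  classical
  have := T1.finite
  have := T2.finite
  have hXf : Finite X := Nat.finite_of_card_ne_zero (by omega)
  have := Fintype.ofFinite X
  have := Fintype.ofFinite V2
  have : Finite (DisplayVertex T1.leaf T2.leaf) := by unfold DisplayVertex; infer_instance
  rw [Nat.card_eq_fintype_card]
  have hX' := hX
  rw [Nat.card_eq_fintype_card] at hX
  obtain ⟨I, K, hI, hIc, hKI, hK1, hK2, hKc⟩ := exists_K T2 hX
  have hKle := Finset.card_le_card hKI
  refine ⟨K.card, by omega, hKc, ?_⟩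
  let R : Finset (DisplayVertex T1.leaf T2.leaf) := (I \ K).image (f2 T1 T2)
  have hRc : R.card + 1 = Fintype.card X - 1 - K.card := by
    rw [Finset.card_image_of_injective _ (f2_inj T1 T2), Finset.card_sdiff_of_subset hKI]
    omega
  rw [← hRc]
  have hf1 : ∀ v, f1 T1 T2 v ∉ R := by
    intro v hv
    obtain ⟨w, hw, he⟩ := Finset.mem_image.mp hv
    exact f1_ne_f2 T1 T2 v w ((hI w).mp (Finset.mem_sdiff.mp hw).1) he.symm
  obtain ⟨rt⟩ : Nonempty V1 := T1.connected.nonempty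
  obtain ⟨p, r, hp, hr, hpadj⟩ := exists_parent T1.graph ⟨T1.connected, T1.acyclic⟩ rt
  let a : V2 → V1 := fun k => if h : ∃ x, T2.graph.Adj k (T2.leaf x) then T1.leaf h.choose else rt
  let par : V1 ⊕ V2 → V1 := Sum.elim p a
  let rk : V1 ⊕ V2 → ℕ := Sum.elim r (fun k => r (a k) + 1)
  have hmem2 : ∀ u : {x // x ∉ R}, ∀ w, u.1 = f2 T1 T2 w → (∀ y, T2.leaf y ≠ w) → w ∈ K := by
    intro u w hu hw
    by_contra hk
    apply u.2
    rw [hu]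
    exact Finset.mem_image_of_mem _ (Finset.mem_sdiff.mpr ⟨(hI w).mpr hw, hk⟩)
  have haux : ∀ u v : {x // x ∉ R}, ∀ w x, T2.graph.Adj w (T2.leaf x) → u.1 = f2 T1 T2 w →
      v.1 = f2 T1 T2 (T2.leaf x) → (⟨f1 T1 T2 (par u.1.1), hf1 _⟩ : {x // x ∉ R}) = v := by
    intro u v w x hadj hu hv
    apply Subtype.ext
    have hw : ∀ y, T2.leaf y ≠ w := by
      rintro y rfl
      exact leaf_not_adj T2 hX' _ _ hadj
    have hwK := hmem2 u w hu hw
    rw [hv, f2_leaf, hu, f2_val _ _ _ hw]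
    have hex : ∃ x, T2.graph.Adj w (T2.leaf x) := ⟨x, hadj⟩
    change f1 T1 T2 (a w) = _
    simp only [a, hex, dif_pos]
    rw [hK1 w hwK _ _ hex.choose_spec hadj]
  refine td_of_parent (DG T1 T2) R ⟨f1 T1 T2 rt, hf1 _⟩ (fun x => ⟨f1 T1 T2 (par x.1.1), hf1 _⟩)
    (fun x => rk x.1.1) ?_ ?_ ?_
  · apply Subtype.ext
    change f1 T1 T2 (p rt) = _
    rw [hp]
  · intro v hv
    rcases dv_cases T1 T2 v.1 with ⟨w, hw⟩ | ⟨w, hwl, hw⟩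
    · have hne : w ≠ rt := by
        rintro rfl
        exact hv (Subtype.ext hw)
      have hw' : v.1.1 = Sum.inl w := by rw [hw]; rfl
      change rk (Sum.inl (par v.1.1)) < rk v.1.1
      rw [hw']
      exact hr w hne
    · have hw' : v.1.1 = Sum.inr w := by rw [hw, f2_val _ _ _ hwl]
      change rk (Sum.inl (par v.1.1)) < rk v.1.1
      rw [hw']
      exact Nat.lt_succ_self _
  · intro u v huv
    rcases dg_adj T1 T2 huv with ⟨u', v', h, hu, hv⟩ | ⟨u', v', h, hu, hv⟩
    · rcases hpadj u' v' h with e | e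
      · left
        apply Subtype.ext
        change f1 T1 T2 (par u.1.1) = v.1
        rw [hu, hv, f1_val]
        change f1 T1 T2 (p u') = _
        rw [e]
      · right
        apply Subtype.ext
        change f1 T1 T2 (par v.1.1) = u.1
        rw [hu, hv, f1_val]
        change f1 T1 T2 (p v') = _
        rw [e]
    · by_cases hul : ∃ x, T2.leaf x = u'
      · obtain ⟨x, rfl⟩ := hul
        exact Or.inr (haux v u v' x h.symm hv hu)
      · by_cases hvl : ∃ x, T2.leaf x = v'
        · obtain ⟨x, rfl⟩ := hvl
          exact Or.inl (haux u v u' x h hu hv)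
        · exfalso
          exact hK2 u' (hmem2 u u' hu fun y hy => hul ⟨y, hy⟩) v'
            (hmem2 v v' hv fun y hy => hvl ⟨y, hy⟩) h

lemma dtw_upper {V1 V2 X : Type*} (T1 : PhyloTree V1 X) (T2 : PhyloTree V2 X)
    (hX : 4 ≤ Nat.card X) :
    dtw T1 T2 ≤ Nat.card X - 3 - (Nat.sqrt (Nat.card X - 2) - 1) / 2 := by
  obtain ⟨κ, h1, h2, h3⟩ := td_upper T1 T2 hX
  have h4 : treewidth (DG T1 T2) ≤ Nat.card X - 1 - κ := Nat.sInf_le h3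
  have h5 : (Nat.sqrt (Nat.card X - 2) - 1) / 2 ≤ κ := by
    have hs := Nat.sqrt_le' (Nat.card X - 2)
    generalize Nat.sqrt (Nat.card X - 2) = s at hs
    by_contra hlt
    push Not at hlt
    have : 2 * κ + 3 ≤ s := by omega
    have : (2 * κ + 3) ^ 2 ≤ s ^ 2 := Nat.pow_le_pow_left this 2
    have h6 : Nat.card X ≤ 4 * κ + 4 := by omega
    have h7 : (2 * κ + 3) ^ 2 = 4 * (κ * κ) + 12 * κ + 9 := by ring
    have h8 : 0 ≤ κ * κ := Nat.zero_le _
    omega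
  unfold dtw
  change treewidth (DG T1 T2) - 2 ≤ _
  omega

end DTW


open SimpleGraph
namespace DTW

/-- Counting argument for a sparse bipartite expander. -/
lemma exists_expander (m : ℕ) (hm : 0 < m) :
    ∃ f : Fin (100 * m) → Fin m × Fin m, ∀ A B : Finset (Fin m), m ≤ 8 * A.card → m ≤ 8 * B.card →
      ∃ e, (f e).1 ∈ A ∧ (f e).2 ∈ B := by
  classical
  by_contra hcon
  push Not at hcon
  let P : Finset (Finset (Fin m) × Finset (Fin m)) :=
    Finset.univ.filter (fun q => m ≤ 8 * q.1.card ∧ m ≤ 8 * q.2.card)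
  let F : Finset (Fin m) × Finset (Fin m) → Finset (Fin (100 * m) → Fin m × Fin m) :=
    fun q => Fintype.piFinset (fun _ => (q.1 ×ˢ q.2)ᶜ)
  have hcover : (Finset.univ : Finset (Fin (100 * m) → Fin m × Fin m)) ⊆ P.biUnion F := by
    intro f _
    obtain ⟨A, B, hA, hB, h⟩ := hcon f
    rw [Finset.mem_biUnion]
    refine ⟨(A, B), by simp [P, hA, hB], ?_⟩
    simp only [F, Fintype.mem_piFinset, Finset.mem_compl, Finset.mem_product]
    intro e he
    exact h e he.1 he.2
  have h1 := (Finset.card_le_card hcover).trans Finset.card_biUnion_le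
  have h2 : ∀ q ∈ P, 64 ^ (100 * m) * (F q).card ≤ 63 ^ (100 * m) * (m * m) ^ (100 * m) := by
    intro q hq
    simp only [P, Finset.mem_filter, Finset.mem_univ, true_and] at hq
    have hc : (F q).card = (m * m - q.1.card * q.2.card) ^ (100 * m) := by
      simp only [F, Fintype.card_piFinset, Finset.card_compl, Finset.card_product,
        Fintype.card_prod, Fintype.card_fin, Finset.prod_const, Finset.card_univ]
    rw [hc, ← mul_pow, ← mul_pow]
    apply Nat.pow_le_pow_left
    have h3 : m * m ≤ (8 * q.1.card) * (8 * q.2.card) := Nat.mul_le_mul hq.1 hq.2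
    have h4 : (8 * q.1.card) * (8 * q.2.card) = 64 * (q.1.card * q.2.card) := by ring
    omega
  have hPc : P.card ≤ 4 ^ m := by
    refine (Finset.card_le_univ P).trans ?_
    simp only [Fintype.card_prod, Fintype.card_finset, Fintype.card_fin]
    rw [← mul_pow]
    norm_num
  have h5 : 64 ^ (100 * m) * ∑ q ∈ P, (F q).card ≤ 4 ^ m * (63 ^ (100 * m) * (m * m) ^ (100 * m)) := by
    rw [Finset.mul_sum]
    refine (Finset.sum_le_card_nsmul _ _ _ h2).trans ?_
    rw [smul_eq_mul]
    exact Nat.mul_le_mul_right _ hPc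
  have h6 : (Finset.univ : Finset (Fin (100 * m) → Fin m × Fin m)).card = (m * m) ^ (100 * m) := by
    simp
  rw [h6] at h1
  have h7 := (Nat.mul_le_mul_left (64 ^ (100 * m)) h1).trans h5
  rw [← mul_assoc] at h7
  have h8 : 64 ^ (100 * m) ≤ 4 ^ m * 63 ^ (100 * m) :=
    Nat.le_of_mul_le_mul_right h7 (by positivity)
  rw [pow_mul, pow_mul, ← mul_pow] at h8
  have h9 : 4 * 63 ^ 100 < 64 ^ 100 := by norm_num
  have h10 := Nat.pow_lt_pow_left h9 hm.ne'
  omega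

lemma exists_edges (n m : ℕ) (hm : 0 < m) (hn : 101 * m ≤ n) :
    ∃ f : Fin n → Fin m × Fin m, (∀ g, ∃ e, (f e).1 = g) ∧ (∀ g, ∃ e, (f e).2 = g) ∧
      ∀ A B : Finset (Fin m), m ≤ 8 * A.card → m ≤ 8 * B.card →
      ∃ e, (f e).1 ∈ A ∧ (f e).2 ∈ B := by
  obtain ⟨f, hf⟩ := exists_expander m hm
  let F : Fin n → Fin m × Fin m := fun e =>
    if h : e.1 < m then (⟨e.1, h⟩, ⟨e.1, h⟩)
    else if h' : e.1 - m < 100 * m then f ⟨e.1 - m, h'⟩ else (⟨0, hm⟩, ⟨0, hm⟩)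
  have hF : ∀ g : Fin m, F ⟨g.1, by omega⟩ = (g, g) := by
    intro g
    simp [F, g.2]
  refine ⟨F, fun g => ⟨_, by rw [hF g]⟩, fun g => ⟨_, by rw [hF g]⟩, ?_⟩
  intro A B hA hB
  obtain ⟨e, he⟩ := hf A B hA hB
  refine ⟨⟨e.1 + m, by omega⟩, ?_⟩
  have : F ⟨e.1 + m, by omega⟩ = f e := by
    simp [F]
  rw [this]
  exact he

/-- Expanding families of subtrees cannot be thin. -/
theorem expander_tree {ι : Type*} [Finite ι] (t : SimpleGraph ι) (ht : t.IsTree) (m s : ℕ)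
    (hm : 0 < m) (hs : 8 * s ≤ m) (L R : Fin m → Set ι)
    (hLn : ∀ g, (L g).Nonempty) (hRn : ∀ g, (R g).Nonempty)
    (hLc : ∀ g, Conn t (L g)) (hRc : ∀ g, Conn t (R g))
    (hLs : ∀ i, {g | i ∈ L g}.ncard ≤ s) (hRs : ∀ i, {g | i ∈ R g}.ncard ≤ s)
    (hE : ∀ A B : Finset (Fin m), m ≤ 8 * A.card → m ≤ 8 * B.card →
      ∃ a ∈ A, ∃ b ∈ B, (L a ∩ R b).Nonempty) : False := by
  classical
  choose pL hpL using hLn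
  choose pR hpR using hRn
  let mk : ∀ i : ι, ι → (restr t {i}ᶜ).ConnectedComponent := fun i a =>
    (restr t {i}ᶜ).connectedComponentMk a
  have hmk : ∀ i (S : Set ι), Conn t S → i ∉ S → ∀ a ∈ S, ∀ b ∈ S, mk i a = mk i b := by
    intro i S hS hi a ha b hb
    apply ConnectedComponent.sound
    refine (hS a ha b hb).mono (restr_mono t ?_)
    intro c hc h
    exact hi (h ▸ hc)
  have hheavy : ∀ i, ∃ c : (restr t {i}ᶜ).ConnectedComponent,
      m < 2 * (Finset.univ.filter (fun g => i ∉ L g ∧ mk i (pL g) = c)).card := by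
    intro i
    by_contra hcon
    push Not at hcon
    let UL := Finset.univ.filter (fun g => i ∉ L g)
    let UR := Finset.univ.filter (fun g => i ∉ R g)
    have hcnt : ∀ Q : Fin m → Set ι, {g | i ∈ Q g}.ncard ≤ s →
        m ≤ (Finset.univ.filter (fun g => i ∉ Q g)).card + s := by
      intro Q hQ
      have e1 : {g | i ∈ Q g}.ncard = (Finset.univ.filter (fun g => i ∈ Q g)).card := by
        rw [← Set.ncard_coe_finset]; congr 1; ext g; simp
      have e2 := Finset.card_filter_add_card_filter_not (s := (Finset.univ : Finset (Fin m)))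
        (fun g => i ∈ Q g)
      rw [Finset.card_univ, Fintype.card_fin] at e2
      omega
    have hUL : m ≤ UL.card + s := hcnt L (hLs i)
    have hUR : m ≤ UR.card + s := hcnt R (hRs i)
    let AJ : Finset (restr t {i}ᶜ).ConnectedComponent → Finset (Fin m) :=
      fun J => UL.filter (fun g => mk i (pL g) ∈ J)
    have hex : ∃ k, ∃ J : Finset (restr t {i}ᶜ).ConnectedComponent, J.card = k ∧ m ≤ 4 * (AJ J).card := by
      refine ⟨_, UL.image (fun g => mk i (pL g)), rfl, ?_⟩
      have : AJ (UL.image (fun g => mk i (pL g))) = UL := by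
        apply Finset.filter_true_of_mem
        intro g hg
        exact Finset.mem_image_of_mem _ hg
      rw [this]
      omega
    obtain ⟨J, hJk, hJ⟩ := Nat.find_spec hex
    have hJmin : ∀ J' : Finset (restr t {i}ᶜ).ConnectedComponent, J'.card < J.card → 4 * (AJ J').card < m := by
      intro J' hlt
      by_contra hge
      rw [hJk] at hlt
      exact Nat.find_min hex hlt ⟨J', rfl, not_lt.mp hge⟩
    have hJne : J.Nonempty := by
      rw [Finset.nonempty_iff_ne_empty]
      rintro rfl
      simp [AJ] at hJ
      omega
    obtain ⟨c, hc⟩ := hJne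
    have h1 := hJmin (J.erase c) (Finset.card_erase_lt_of_mem hc)
    have h2 : (AJ J).card ≤ (AJ (J.erase c)).card +
        (Finset.univ.filter (fun g => i ∉ L g ∧ mk i (pL g) = c)).card := by
      refine le_trans (Finset.card_le_card ?_) (Finset.card_union_le _ _)
      intro g hg
      simp only [AJ, UL, Finset.mem_filter, Finset.mem_univ, true_and, Finset.mem_union,
        Finset.mem_erase] at hg ⊢
      tauto
    have h3 := hcon c
    have h4 : (AJ J).card + (UL.filter (fun g => ¬ mk i (pL g) ∈ J)).card = UL.card :=
      Finset.card_filter_add_card_filter_not _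
    have h5 : (UR.filter (fun g => mk i (pR g) ∈ J)).card +
        (UR.filter (fun g => ¬ mk i (pR g) ∈ J)).card = UR.card :=
      Finset.card_filter_add_card_filter_not _
    have hclash : ∀ a b, i ∉ L a → i ∉ R b → (L a ∩ R b).Nonempty → mk i (pL a) = mk i (pR b) := by
      rintro a b ha hb ⟨w, hw1, hw2⟩
      rw [hmk i (L a) (hLc a) ha _ (hpL a) w hw1, hmk i (R b) (hRc b) hb _ (hpR b) w hw2]
    by_cases h6 : m ≤ 8 * (UR.filter (fun g => mk i (pR g) ∈ J)).card
    · obtain ⟨a, ha, b, hb, hab⟩ := hE (UL.filter (fun g => ¬ mk i (pL g) ∈ J)) _ (by omega) h6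
      simp only [UL, UR, Finset.mem_filter, Finset.mem_univ, true_and] at ha hb
      apply ha.2
      rw [hclash a b ha.1 hb.1 hab]
      exact hb.2
    · obtain ⟨a, ha, b, hb, hab⟩ := hE (AJ J) (UR.filter (fun g => ¬ mk i (pR g) ∈ J))
        (by omega) (by omega)
      simp only [AJ, UL, UR, Finset.mem_filter, Finset.mem_univ, true_and] at ha hb
      apply hb.2
      rw [← hclash a b ha.1 hb.1 hab]
      exact ha.2
  choose c hc using hheavy
  refine helly t ht (fun i => {a | mk i a = c i}) ?_ ?_ ?_ ?_
  · intro i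
    have : 0 < (Finset.univ.filter (fun g => i ∉ L g ∧ mk i (pL g) = c i)).card := by
      have := hc i; omega
    obtain ⟨g, hg⟩ := Finset.card_pos.mp this
    exact ⟨pL g, (Finset.mem_filter.mp hg).2.2⟩
  · intro i hi
    have : 0 < (Finset.univ.filter (fun g => i ∉ L g ∧ mk i (pL g) = c i)).card := by
      have := hc i; omega
    obtain ⟨g, hg⟩ := Finset.card_pos.mp this
    obtain ⟨-, hg1, hg2⟩ := Finset.mem_filter.mp hg
    have hr : (restr t {i}ᶜ).Reachable (pL g) i :=
      ConnectedComponent.exact (hg2.trans (show mk i i = c i from hi).symm)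
    refine restr_mem_of_reachable t {i}ᶜ ?_ hr rfl
    intro h
    exact hg1 ((show pL g = i from h) ▸ hpL g)
  · intro i a ha b hb
    obtain ⟨p⟩ : (restr t {i}ᶜ).Reachable a b :=
      ConnectedComponent.exact ((show mk i a = c i from ha).trans (show mk i b = c i from hb).symm)
    induction p with
    | nil => exact Reachable.refl _
    | cons h q ih =>
      have hv : mk i _ = c i := (ConnectedComponent.sound h.reachable).symm.trans ha
      refine Reachable.trans (Adj.reachable (G := restr t {a | mk i a = c i}) ?_) (ih hv hb)
      exact ⟨h.1, ha, hv⟩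
  · intro i j
    have hinter : (Finset.univ.filter (fun g => i ∉ L g ∧ mk i (pL g) = c i) ∩
        Finset.univ.filter (fun g => j ∉ L g ∧ mk j (pL g) = c j)).Nonempty := by
      rw [← Finset.card_pos]
      have e := Finset.card_union_add_card_inter
        (Finset.univ.filter (fun g => i ∉ L g ∧ mk i (pL g) = c i))
        (Finset.univ.filter (fun g => j ∉ L g ∧ mk j (pL g) = c j))
      have e2 := Finset.card_le_univ (Finset.univ.filter (fun g => i ∉ L g ∧ mk i (pL g) = c i) ∪
        Finset.univ.filter (fun g => j ∉ L g ∧ mk j (pL g) = c j))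
      rw [Fintype.card_fin] at e2
      have := hc i
      have := hc j
      omega
    obtain ⟨g, hg⟩ := hinter
    rw [Finset.mem_inter, Finset.mem_filter, Finset.mem_filter] at hg
    exact ⟨pL g, hg.1.2.2, hg.2.2.2⟩

end DTW


open SimpleGraph
namespace DTW

/-- Vertices of the caterpillar with `n` leaves: a spine `0, …, n-1` (whose ends are leaves)
and pendant leaves at the inner spine vertices. -/
def CatV (n : ℕ) : Type := {v : ℕ × Bool // v.1 < n ∧ (v.2 = true → 0 < v.1 ∧ v.1 + 1 < n)}

/-- Spine vertex. -/
def sp {n : ℕ} (k : ℕ) (hk : k < n) : CatV n := ⟨(k, false), hk, by simp⟩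

/-- Pendant vertex. -/
def pd {n : ℕ} (k : ℕ) (h0 : 0 < k) (hk : k + 1 < n) : CatV n :=
  ⟨(k, true), by simp only; omega, fun _ => ⟨h0, hk⟩⟩

lemma cat_cases {n : ℕ} (v : CatV n) :
    (∃ k hk, v = sp k hk) ∨ (∃ k h0 hk, v = pd k h0 hk) := by
  obtain ⟨⟨k, b⟩, h⟩ := v
  cases b
  · exact Or.inl ⟨k, h.1, rfl⟩
  · exact Or.inr ⟨k, (h.2 rfl).1, (h.2 rfl).2, rfl⟩

/-- Parent of a caterpillar vertex. -/
def cpar {n : ℕ} (v : CatV n) : CatV n :=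
  ⟨(if v.1.2 then v.1.1 else v.1.1 - 1, false), by
    have := v.2.1
    simp only
    split_ifs <;> omega, by simp⟩

/-- The caterpillar graph. -/
def catG (n : ℕ) : SimpleGraph (CatV n) where
  Adj u v := u ≠ v ∧ (cpar u = v ∨ cpar v = u)
  symm := ⟨fun _ _ h => ⟨h.1.symm, h.2.symm⟩⟩
  loopless := ⟨fun _ h => h.1 rfl⟩

lemma cpar_sp {n : ℕ} (k : ℕ) (hk : k < n) : cpar (sp k hk) = sp (k - 1) (by omega) := rfl

lemma cpar_pd {n : ℕ} (k : ℕ) (h0 : 0 < k) (hk : k + 1 < n) :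
    cpar (pd k h0 hk) = sp k (by omega) := rfl

lemma sp_inj {n : ℕ} {k l : ℕ} {hk : k < n} {hl : l < n} : sp k hk = sp l hl ↔ k = l :=
  ⟨fun h => congrArg (fun v : CatV n => v.1.1) h, by rintro rfl; rfl⟩

lemma pd_inj {n : ℕ} {k l : ℕ} {hk hk' hl hl'} :
    (pd k hk hk' : CatV n) = pd l hl hl' ↔ k = l :=
  ⟨fun h => congrArg (fun v : CatV n => v.1.1) h, by rintro rfl; rfl⟩

lemma sp_ne_pd {n : ℕ} {k l : ℕ} {hk hl hl'} : (sp k hk : CatV n) ≠ pd l hl hl' :=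
  fun h => Bool.noConfusion (congrArg (fun v : CatV n => v.1.2) h)

lemma adj_sp_sp {n : ℕ} {k l : ℕ} {hk : k < n} {hl : l < n} :
    (catG n).Adj (sp k hk) (sp l hl) ↔ (k + 1 = l ∨ l + 1 = k) := by
  change (_ ≠ _ ∧ (_ ∨ _)) ↔ _
  rw [cpar_sp, cpar_sp, Ne, sp_inj, sp_inj, sp_inj]
  omega

lemma adj_sp_pd {n : ℕ} {k l : ℕ} {hk hl hl'} :
    (catG n).Adj (sp k hk) (pd l hl hl') ↔ k = l := by
  change (_ ≠ _ ∧ (_ ∨ _)) ↔ _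
  rw [cpar_sp, cpar_pd, sp_inj]
  constructor
  · rintro ⟨-, h | h⟩
    · exact absurd h sp_ne_pd
    · exact h.symm
  · intro h
    exact ⟨sp_ne_pd, Or.inr h.symm⟩

lemma not_adj_pd_pd {n : ℕ} {k l : ℕ} {hk hk' hl hl'} :
    ¬ (catG n).Adj (pd k hk hk') (pd l hl hl') := by
  rintro ⟨-, h | h⟩
  · rw [cpar_pd] at h; exact sp_ne_pd h
  · rw [cpar_pd] at h; exact sp_ne_pd h

instance catV_finite (n : ℕ) : Finite (CatV n) := by
  have : Function.Injective (fun v : CatV n => ((⟨v.1.1, v.2.1⟩, v.1.2) : Fin n × Bool)) := by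
    rintro ⟨⟨a, b⟩, h⟩ ⟨⟨c, d⟩, h'⟩ he
    simp only [Prod.mk.injEq, Fin.mk.injEq] at he
    apply Subtype.ext
    exact Prod.ext he.1 he.2
  exact Finite.of_injective _ this

lemma catG_tree (n : ℕ) (hn : 4 ≤ n) : (catG n).IsTree := by
  refine parent_tree (catG n) (sp 0 (by omega)) cpar (fun v => v.1.1 + if v.1.2 then 1 else 0)
    rfl ?_ (fun _ _ => Iff.rfl)
  intro v hv
  rcases cat_cases v with ⟨k, hk, rfl⟩ | ⟨k, h0, hk, rfl⟩
  · rw [Ne, sp_inj] at hv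
    change k - 1 + 0 < k + 0
    omega
  · change k + 0 < k + 1
    omega

/-- Leaf at position `k`. -/
def cleaf {n : ℕ} (k : Fin n) : CatV n :=
  if h : 0 < k.1 ∧ k.1 + 1 < n then pd k.1 h.1 h.2 else sp k.1 k.2

lemma cleaf_pos {n : ℕ} (k : Fin n) : (cleaf k).1.1 = k.1 := by
  unfold cleaf; split_ifs <;> rfl

lemma cleaf_inj {n : ℕ} : Function.Injective (cleaf (n := n)) := by
  intro a b h
  apply Fin.ext
  rw [← cleaf_pos a, ← cleaf_pos b, h]

/-- The caterpillar tree with label `x` at position `π x`. -/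
def catT (n : ℕ) (hn : 4 ≤ n) (π : Equiv.Perm (Fin n)) : PhyloTree (CatV n) (Fin n) where
  graph := catG n
  finite := inferInstance
  connected := (catG_tree n hn).connected
  leaf x := cleaf (π x)
  leaf_inj := cleaf_inj.comp π.injective
  leaf_deg x := by
    rw [Set.ncard_eq_one]
    generalize π x = k
    unfold cleaf
    split_ifs with h
    · refine ⟨sp k.1 k.2, ?_⟩
      ext v
      rw [mem_neighborSet, Set.mem_singleton_iff]
      rcases cat_cases v with ⟨l, hl, rfl⟩ | ⟨l, h0, hl, rfl⟩
      · rw [adj_comm, adj_sp_pd, sp_inj]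
      · exact ⟨fun h => absurd h not_adj_pd_pd, fun h => absurd h.symm sp_ne_pd⟩
    · have hk := k.2
      by_cases hk0 : k.1 = 0
      · refine ⟨sp 1 (by omega), ?_⟩
        ext v
        rw [mem_neighborSet, Set.mem_singleton_iff]
        rcases cat_cases v with ⟨l, hl, rfl⟩ | ⟨l, h0, hl, rfl⟩
        · rw [adj_sp_sp, sp_inj]; omega
        · rw [adj_sp_pd]
          exact ⟨fun h => by omega, fun h => absurd h.symm sp_ne_pd⟩
      · refine ⟨sp (k.1 - 1) (by omega), ?_⟩
        ext v
        rw [mem_neighborSet, Set.mem_singleton_iff]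
        rcases cat_cases v with ⟨l, hl, rfl⟩ | ⟨l, h0, hl, rfl⟩
        · rw [adj_sp_sp, sp_inj]; omega
        · rw [adj_sp_pd]
          exact ⟨fun h => by omega, fun h => absurd h.symm sp_ne_pd⟩
  internal_deg v hv := by
    have hv' : ∀ k, cleaf k ≠ v := by
      intro k
      have := hv (π.symm k)
      rwa [Equiv.apply_symm_apply] at this
    rw [Set.ncard_eq_three]
    rcases cat_cases v with ⟨k, hk, rfl⟩ | ⟨k, h0, hk, rfl⟩
    · have hin : 0 < k ∧ k + 1 < n := by
        by_contra h
        apply hv' ⟨k, hk⟩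
        unfold cleaf
        rw [dif_neg h]
      refine ⟨sp (k - 1) (by omega), sp (k + 1) hin.2, pd k hin.1 hin.2, ?_, sp_ne_pd, sp_ne_pd, ?_⟩
      · rw [Ne, sp_inj]; omega
      · ext v
        rw [mem_neighborSet, Set.mem_insert_iff, Set.mem_insert_iff, Set.mem_singleton_iff]
        rcases cat_cases v with ⟨l, hl, rfl⟩ | ⟨l, h0, hl, rfl⟩
        · rw [adj_sp_sp, sp_inj, sp_inj]
          have : (sp l hl : CatV n) ≠ pd k hin.1 hin.2 := sp_ne_pd
          simp only [this, or_false]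
          omega
        · rw [adj_sp_pd, pd_inj]
          constructor
          · intro h; exact Or.inr (Or.inr h.symm)
          · rintro (h | h | h)
            · exact absurd h.symm sp_ne_pd
            · exact absurd h.symm sp_ne_pd
            · exact h.symm
    · exfalso
      apply hv' ⟨k, by omega⟩
      unfold cleaf
      rw [dif_pos (⟨h0, hk⟩ : 0 < k ∧ k + 1 < n)]
  acyclic := (catG_tree n hn).isAcyclic

lemma cat_conn {n : ℕ} (S : Set (CatV n))
    (hS : ∀ u ∈ S, ∀ v ∈ S, ∀ k (hk : k < n), u.1.1 ≤ k → k ≤ v.1.1 → sp k hk ∈ S) :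
    Conn (catG n) S := by
  have hspine : ∀ d a (h : a + d < n), sp a (by omega) ∈ S → sp (a + d) h ∈ S →
      (restr (catG n) S).Reachable (sp a (by omega)) (sp (a + d) h) := by
    intro d
    induction d with
    | zero => intro a h _ _; exact Reachable.refl _
    | succ d ih =>
      intro a h h1 h2
      have h3 : sp (a + d) (by omega) ∈ S := hS _ h1 _ h2 (a + d) (by omega)
        (by change a ≤ a + d; omega) (by change a + d ≤ a + (d + 1); omega)
      refine (ih a (by omega) h1 h3).trans ?_
      refine Adj.reachable (G := restr (catG n) S) ⟨?_, h3, h2⟩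
      rw [adj_sp_sp]
      left; omega
  have hspine2 : ∀ a b (ha : a < n) (hb : b < n), a ≤ b → sp a ha ∈ S → sp b hb ∈ S →
      (restr (catG n) S).Reachable (sp a ha) (sp b hb) := by
    intro a b ha hb hab h1 h2
    obtain ⟨d, rfl⟩ := Nat.exists_eq_add_of_le hab
    exact hspine d a hb h1 h2
  have htop : ∀ v ∈ S, sp v.1.1 v.2.1 ∈ S ∧ (restr (catG n) S).Reachable v (sp v.1.1 v.2.1) := by
    intro v hv
    have h1 : sp v.1.1 v.2.1 ∈ S := hS v hv v hv _ _ le_rfl le_rfl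
    refine ⟨h1, ?_⟩
    rcases cat_cases v with ⟨k, hk, rfl⟩ | ⟨k, h0, hk, rfl⟩
    · exact Reachable.refl _
    · refine (Adj.reachable (G := restr (catG n) S) ⟨?_, h1, hv⟩).symm
      exact adj_sp_pd.mpr rfl
  have hle : ∀ u ∈ S, ∀ v ∈ S, u.1.1 ≤ v.1.1 → (restr (catG n) S).Reachable u v := by
    intro u hu v hv huv
    obtain ⟨h1, h2⟩ := htop u hu
    obtain ⟨h3, h4⟩ := htop v hv
    refine h2.trans (Reachable.trans ?_ h4.symm)
    exact hspine2 _ _ _ _ huv h1 h3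
  intro u hu v hv
  rcases le_total u.1.1 v.1.1 with h | h
  · exact hle u hu v hv h
  · exact (hle v hv u hu h).symm

lemma conn_image {V W : Type*} (G : SimpleGraph V) (H : SimpleGraph W) (φ : V → W)
    (hφ : ∀ u v, G.Adj u v → H.Adj (φ u) (φ v)) (S : Set V) (hS : Conn G S) :
    Conn H (φ '' S) := by
  rintro _ ⟨a, ha, rfl⟩ _ ⟨b, hb, rfl⟩
  exact (hS a ha b hb).map (⟨φ, fun {x y} h => ⟨hφ _ _ h.1, ⟨x, h.2.1, rfl⟩, ⟨y, h.2.2, rfl⟩⟩⟩ :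
    restr G S →g restr H (φ '' S))

end DTW


open SimpleGraph
namespace DTW

lemma thin {V D : Type*} [Nonempty V] (φ : V → D) (hφ : Function.Injective φ) {m : ℕ} (pos : V → Fin m)
    (b : Finset D) : {g | ∃ d ∈ φ '' {v | pos v = g}, d ∈ b}.ncard ≤ b.card := by
  have hex : ∀ g, (∃ d ∈ φ '' {v | pos v = g}, d ∈ b) → ∃ v, pos v = g ∧ φ v ∈ b := by
    rintro g ⟨_, ⟨v, hv, rfl⟩, hb⟩
    exact ⟨v, hv, hb⟩
  choose! w hw1 hw2 using hex
  rw [← Set.ncard_coe_finset b]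
  refine Set.ncard_le_ncard_of_injOn (fun g => φ (w g)) (fun g hg => hw2 g hg) ?_ (Set.toFinite _)
  intro g hg g' hg' h
  have := hφ h
  rw [← hw1 g hg, ← hw1 g' hg', this]

lemma block_conn {n m : ℕ} (γ : Fin n → Fin m) (hγ : Monotone γ) (g : Fin m) :
    Conn (catG n) {v | γ ⟨v.1.1, v.2.1⟩ = g} := by
  apply cat_conn
  intro u hu v hv k hk h1 h2
  change γ ⟨k, hk⟩ = g
  apply le_antisymm
  · rw [← (show γ ⟨v.1.1, v.2.1⟩ = g from hv)]
    exact hγ h2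
  · rw [← (show γ ⟨u.1.1, u.2.1⟩ = g from hu)]
    exact hγ h1

theorem lower_big (n m : ℕ) (hn : 4 ≤ n) (hm : 0 < m) (hnm : 101 * m ≤ n) :
    ∃ T1 T2 : PhyloTree (CatV n) (Fin n), ∀ k, HasTreeDecompWidthLE (DG T1 T2) k →
      m < 8 * (k + 1) := by
  obtain ⟨f, hf1, hf2, hf⟩ := exists_edges n m hm hnm
  let σ1 := Tuple.sort (fun e => (f e).1)
  let σ2 := Tuple.sort (fun e => (f e).2)
  let γ1 : Fin n → Fin m := fun k => (f (σ1 k)).1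
  let γ2 : Fin n → Fin m := fun k => (f (σ2 k)).2
  have hγ1 : Monotone γ1 := Tuple.monotone_sort (fun e => (f e).1)
  have hγ2 : Monotone γ2 := Tuple.monotone_sort (fun e => (f e).2)
  let T1 := catT n hn σ1.symm
  let T2 := catT n hn σ2.symm
  refine ⟨T1, T2, ?_⟩
  rintro k ⟨N, t, bag, ht, h1, h2, h3, h4⟩
  by_contra hcon
  have hne : Nonempty (CatV n) := ⟨sp 0 (by omega)⟩
  let P1 : CatV n → Fin m := fun v => γ1 ⟨v.1.1, v.2.1⟩
  let P2 : CatV n → Fin m := fun v => γ2 ⟨v.1.1, v.2.1⟩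
  have hP1 : ∀ e, P1 (T1.leaf e) = (f e).1 := by
    intro e
    have : (⟨(T1.leaf e).1.1, (T1.leaf e).2.1⟩ : Fin n) = σ1.symm e := Fin.ext (cleaf_pos _)
    simp only [P1, γ1, this, Equiv.apply_symm_apply]
  have hP2 : ∀ e, P2 (T2.leaf e) = (f e).2 := by
    intro e
    have : (⟨(T2.leaf e).1.1, (T2.leaf e).2.1⟩ : Fin n) = σ2.symm e := Fin.ext (cleaf_pos _)
    simp only [P2, γ2, this, Equiv.apply_symm_apply]
  refine expander_tree t ht m (k + 1) hm (not_lt.mp hcon)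
    (fun g => {i | ∃ d ∈ f1 T1 T2 '' {v | P1 v = g}, d ∈ bag i})
    (fun g => {i | ∃ d ∈ f2 T1 T2 '' {v | P2 v = g}, d ∈ bag i}) ?_ ?_ ?_ ?_ ?_ ?_ ?_
  · intro g
    obtain ⟨e, he⟩ := hf1 g
    obtain ⟨i, hi⟩ := h1 (f1 T1 T2 (T1.leaf e))
    exact ⟨i, _, ⟨_, (hP1 e).trans he, rfl⟩, hi⟩
  · intro g
    obtain ⟨e, he⟩ := hf2 g
    obtain ⟨i, hi⟩ := h1 (f2 T1 T2 (T2.leaf e))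
    exact ⟨i, _, ⟨_, (hP2 e).trans he, rfl⟩, hi⟩
  · intro g
    exact nodes_conn (DG T1 T2) t bag h2 h3 _
      (conn_image _ _ _ (fun u v h => f1_adj T1 T2 h) _ (block_conn γ1 hγ1 g))
  · intro g
    exact nodes_conn (DG T1 T2) t bag h2 h3 _
      (conn_image _ _ _ (fun u v h => f2_adj T1 T2 h) _ (block_conn γ2 hγ2 g))
  · intro i
    exact (thin (f1 T1 T2) (f1_inj T1 T2) P1 (bag i)).trans (h4 i)
  · intro i
    exact (thin (f2 T1 T2) (f2_inj T1 T2) P2 (bag i)).trans (h4 i)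
  · intro A B hA hB
    obtain ⟨e, he1, he2⟩ := hf A B hA hB
    obtain ⟨i, hi⟩ := h1 (f1 T1 T2 (T1.leaf e))
    refine ⟨_, he1, _, he2, i, ⟨_, ⟨_, hP1 e, rfl⟩, hi⟩, ⟨_, ⟨_, hP2 e, rfl⟩, ?_⟩⟩
    rw [f2_leaf]
    exact hi

/-- Four disjoint connected pairwise adjacent sets force treewidth at least three. -/
lemma four_blocks {D : Type*} (G : SimpleGraph D) (B : Fin 4 → Set D) (hne : ∀ a, (B a).Nonempty)
    (hc : ∀ a, Conn G (B a)) (hd : ∀ a b, a ≠ b → Disjoint (B a) (B b))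
    (hadj : ∀ a b, a < b → ∃ u ∈ B a, ∃ v ∈ B b, G.Adj u v) (k : ℕ)
    (hk : HasTreeDecompWidthLE G k) : 3 ≤ k := by
  obtain ⟨N, t, bag, ht, h1, h2, h3, h4⟩ := hk
  by_contra hlt
  have hmiss : ∀ i, ∃ a, ∀ d ∈ B a, d ∉ bag i := by
    intro i
    by_contra hcon
    push Not at hcon
    choose d hd1 hd2 using hcon
    have hinj : Function.Injective d := by
      intro a b hab
      by_contra hne
      exact Set.disjoint_left.mp (hd a b hne) (hd1 a) (hab ▸ hd1 b)
    have := Finset.card_le_card_of_injOn (s := (Finset.univ : Finset (Fin 4))) (t := bag i) d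
      (fun a _ => hd2 a) hinj.injOn
    have h5 := h4 i
    simp at this
    omega
  choose a ha using hmiss
  refine helly t ht (fun i => {j | ∃ d ∈ B (a i), d ∈ bag j}) ?_ ?_ ?_ ?_
  · intro i
    obtain ⟨d, hd⟩ := hne (a i)
    obtain ⟨j, hj⟩ := h1 d
    exact ⟨j, d, hd, hj⟩
  · rintro i ⟨d, hd, hdi⟩
    exact ha i d hd hdi
  · intro i
    exact nodes_conn G t bag h2 h3 _ (hc (a i))
  · intro i j
    generalize a i = x
    generalize a j = y
    rcases lt_trichotomy x y with h | h | h
    · obtain ⟨u, hu, v, hv, huv⟩ := hadj x y h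
      obtain ⟨l, hl1, hl2⟩ := h2 u v huv
      exact ⟨l, ⟨u, hu, hl1⟩, ⟨v, hv, hl2⟩⟩
    · subst h
      obtain ⟨d, hd⟩ := hne x
      obtain ⟨j, hj⟩ := h1 d
      exact ⟨j, ⟨d, hd, hj⟩, ⟨d, hd, hj⟩⟩
    · obtain ⟨u, hu, v, hv, huv⟩ := hadj y x h
      obtain ⟨l, hl1, hl2⟩ := h2 u v huv
      exact ⟨l, ⟨v, hv, hl2⟩, ⟨u, hu, hl1⟩⟩

theorem lower_small (n : ℕ) (hn : 4 ≤ n) :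
    ∃ T1 T2 : PhyloTree (CatV n) (Fin n), ∀ k, HasTreeDecompWidthLE (DG T1 T2) k → 3 ≤ k := by
  let x1 : Fin n := ⟨1, by omega⟩
  let x2 : Fin n := ⟨2, by omega⟩
  let x0 : Fin n := ⟨0, by omega⟩
  let xl : Fin n := ⟨n - 1, by omega⟩
  let T1 := catT n hn (Equiv.refl _)
  let T2 := catT n hn (Equiv.swap x1 x2)
  -- positions of the four labels
  have a0 : T1.leaf x0 = sp 0 (by omega) := by
    change cleaf x0 = _
    unfold cleaf; rw [dif_neg (by simp [x0])]
  have a1 : T1.leaf x1 = pd 1 (by omega) (by omega) := by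
    change cleaf x1 = _
    unfold cleaf; rw [dif_pos ⟨by simp [x1], by simp only [x1]; omega⟩]
  have a2 : T1.leaf x2 = pd 2 (by omega) (by omega) := by
    change cleaf x2 = _
    unfold cleaf; rw [dif_pos ⟨by simp [x2], by simp only [x2]; omega⟩]
  have al : T1.leaf xl = sp (n - 1) (by omega) := by
    change cleaf xl = _
    unfold cleaf; rw [dif_neg (by simp only [xl]; omega)]
  have b0 : T2.leaf x0 = sp 0 (by omega) := by
    change cleaf (Equiv.swap x1 x2 x0) = _
    rw [Equiv.swap_apply_of_ne_of_ne (by simp [x0, x1]) (by simp [x0, x2])]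
    exact a0
  have b1 : T2.leaf x1 = pd 2 (by omega) (by omega) := by
    change cleaf (Equiv.swap x1 x2 x1) = _
    rw [Equiv.swap_apply_left]
    exact a2
  have b2 : T2.leaf x2 = pd 1 (by omega) (by omega) := by
    change cleaf (Equiv.swap x1 x2 x2) = _
    rw [Equiv.swap_apply_right]
    exact a1
  have bl : T2.leaf xl = sp (n - 1) (by omega) := by
    change cleaf (Equiv.swap x1 x2 xl) = _
    rw [Equiv.swap_apply_of_ne_of_ne (by simp only [xl, x1, Ne, Fin.mk.injEq]; omega)
      (by simp only [xl, x2, Ne, Fin.mk.injEq]; omega)]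
    exact al
  have hnl : ∀ k (h0 : 0 < k) (hk : k + 1 < n), ∀ x, T2.leaf x ≠ sp k (by omega) := by
    intro k h0 hk x
    change cleaf (Equiv.swap x1 x2 x) ≠ _
    generalize Equiv.swap x1 x2 x = y
    unfold cleaf
    split_ifs with h
    · exact sp_ne_pd.symm
    · rw [Ne, sp_inj]
      rintro h'
      rw [h'] at h
      exact h ⟨h0, hk⟩
  let S0 : Set (CatV n) := {v | v.1.1 ≤ 1}
  let S1 : Set (CatV n) := {v | 2 ≤ v.1.1}
  let S2 : Set (CatV n) := {v | v.1.1 = 1 ∧ v.1.2 = false}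
  let S3 : Set (CatV n) := {v | 2 ≤ v.1.1 ∧ v.1.1 + 1 < n ∧ v.1.2 = false}
  have hS2 : ∀ v ∈ S2, ∀ x, T2.leaf x ≠ v := by
    rintro v ⟨hv, hb⟩
    rcases cat_cases v with ⟨k, hk, rfl⟩ | ⟨k, h0, hk, rfl⟩
    · change k = 1 at hv
      exact hnl k (by omega) (by omega)
    · cases hb
  have hS3 : ∀ v ∈ S3, ∀ x, T2.leaf x ≠ v := by
    rintro v ⟨hv, hv', hb⟩
    rcases cat_cases v with ⟨k, hk, rfl⟩ | ⟨k, h0, hk, rfl⟩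
    · change 2 ≤ k at hv
      change k + 1 < n at hv'
      exact hnl k (by omega) (by omega)
    · cases hb
  have d12 : ∀ (S S' : Set (CatV n)), (∀ v ∈ S', ∀ x, T2.leaf x ≠ v) →
      Disjoint (f1 T1 T2 '' S) (f2 T1 T2 '' S') := by
    intro S S' h
    rw [Set.disjoint_left]
    rintro _ ⟨u, _, rfl⟩ ⟨v, hv, he⟩
    exact f1_ne_f2 T1 T2 u v (h v hv) he.symm
  have c1 : ∀ S : Set (CatV n), Conn (catG n) S → Conn (DG T1 T2) (f1 T1 T2 '' S) :=
    fun S hS => conn_image _ _ _ (fun u v h => f1_adj T1 T2 h) _ hS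
  have c2 : ∀ S : Set (CatV n), Conn (catG n) S → Conn (DG T1 T2) (f2 T1 T2 '' S) :=
    fun S hS => conn_image _ _ _ (fun u v h => f2_adj T1 T2 h) _ hS
  have d01 : Disjoint (f1 T1 T2 '' S0) (f1 T1 T2 '' S1) := by
    rw [Set.disjoint_image_iff (f1_inj T1 T2), Set.disjoint_left]
    intro v h1 h2
    have h1 : v.1.1 ≤ 1 := h1
    have h2 : 2 ≤ v.1.1 := h2
    omega
  have d23 : Disjoint (f2 T1 T2 '' S2) (f2 T1 T2 '' S3) := by
    rw [Set.disjoint_image_iff (f2_inj T1 T2), Set.disjoint_left]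
    intro v h1 h2
    have h1 := h1.1
    have h2 := h2.1
    omega
  let B : Fin 4 → Set (DisplayVertex T1.leaf T2.leaf) :=
    ![f1 T1 T2 '' S0, f1 T1 T2 '' S1, f2 T1 T2 '' S2, f2 T1 T2 '' S3]
  refine ⟨T1, T2, fun k hk => four_blocks (DG T1 T2) B ?_ ?_ ?_ ?_ k hk⟩
  · intro a
    fin_cases a
    · exact ⟨_, sp 0 (by omega), by change 0 ≤ 1; omega, rfl⟩
    · exact ⟨_, sp 2 (by omega), by change 2 ≤ 2; omega, rfl⟩
    · exact ⟨_, sp 1 (by omega), ⟨rfl, rfl⟩, rfl⟩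
    · exact ⟨_, sp 2 (by omega), ⟨by change 2 ≤ 2; omega, by change 2 + 1 < n; omega, rfl⟩, rfl⟩
  · intro a
    fin_cases a
    · refine c1 S0 (cat_conn _ ?_)
      intro u hu v hv k hk h1 h2
      have hv : v.1.1 ≤ 1 := hv
      change k ≤ 1
      omega
    · refine c1 S1 (cat_conn _ ?_)
      intro u hu v hv k hk h1 h2
      have hu : 2 ≤ u.1.1 := hu
      change 2 ≤ k
      omega
    · refine c2 S2 (cat_conn _ ?_)
      intro u hu v hv k hk h1 h2
      have hu := hu.1
      have hv := hv.1
      refine ⟨?_, rfl⟩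
      change k = 1
      omega
    · refine c2 S3 (cat_conn _ ?_)
      intro u hu v hv k hk h1 h2
      have hu := hu.1
      have hv := hv.2.1
      refine ⟨?_, ?_, rfl⟩
      · change 2 ≤ k; omega
      · change k + 1 < n; omega
  · have hlt : ∀ a b, a < b → Disjoint (B a) (B b) := by
      intro a b hab
      fin_cases a <;> fin_cases b <;>
        first
        | exact absurd hab (by decide)
        | exact d01
        | exact d23
        | exact d12 _ _ hS2
        | exact d12 _ _ hS3
    intro a b hab
    rcases lt_or_gt_of_ne hab with h | h
    · exact hlt a b h
    · exact (hlt b a h).symm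
  · have m0 : sp 0 (by omega) ∈ S0 := by change 0 ≤ 1; omega
    have m1 : sp 1 (by omega) ∈ S0 := by change 1 ≤ 1; omega
    have m1' : pd 1 (by omega) (by omega) ∈ S0 := by change 1 ≤ 1; omega
    have m2 : sp 2 (by omega) ∈ S1 := by change 2 ≤ 2; omega
    have m2' : pd 2 (by omega) (by omega) ∈ S1 := by change 2 ≤ 2; omega
    have ml : sp (n - 1) (by omega) ∈ S1 := by change 2 ≤ n - 1; omega
    have q1 : sp 1 (by omega) ∈ S2 := ⟨rfl, rfl⟩
    have q2 : sp 2 (by omega) ∈ S3 :=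
      ⟨by change 2 ≤ 2; omega, by change 2 + 1 < n; omega, rfl⟩
    have ql : sp (n - 2) (by omega) ∈ S3 :=
      ⟨by change 2 ≤ n - 2; omega, by change n - 2 + 1 < n; omega, rfl⟩
    have e01 : ∃ u ∈ f1 T1 T2 '' S0, ∃ v ∈ f1 T1 T2 '' S1, (DG T1 T2).Adj u v :=
      ⟨_, ⟨_, m1, rfl⟩, _, ⟨_, m2, rfl⟩, f1_adj T1 T2 (adj_sp_sp.mpr (by omega))⟩
    have e23 : ∃ u ∈ f2 T1 T2 '' S2, ∃ v ∈ f2 T1 T2 '' S3, (DG T1 T2).Adj u v :=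
      ⟨_, ⟨_, q1, rfl⟩, _, ⟨_, q2, rfl⟩, f2_adj T1 T2 (adj_sp_sp.mpr (by omega))⟩
    have e02 : ∃ u ∈ f1 T1 T2 '' S0, ∃ v ∈ f2 T1 T2 '' S2, (DG T1 T2).Adj u v := by
      refine ⟨_, ⟨_, m0, rfl⟩, _, ⟨_, q1, rfl⟩, ?_⟩
      rw [← a0, ← f2_leaf, b0]
      exact f2_adj T1 T2 (adj_sp_sp.mpr (by omega))
    have e03 : ∃ u ∈ f1 T1 T2 '' S0, ∃ v ∈ f2 T1 T2 '' S3, (DG T1 T2).Adj u v := by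
      refine ⟨_, ⟨_, m1', rfl⟩, _, ⟨_, q2, rfl⟩, ?_⟩
      rw [← a1, ← f2_leaf, b1]
      exact f2_adj T1 T2 (adj_sp_pd.mpr rfl).symm
    have e12 : ∃ u ∈ f1 T1 T2 '' S1, ∃ v ∈ f2 T1 T2 '' S2, (DG T1 T2).Adj u v := by
      refine ⟨_, ⟨_, m2', rfl⟩, _, ⟨_, q1, rfl⟩, ?_⟩
      rw [← a2, ← f2_leaf, b2]
      exact f2_adj T1 T2 (adj_sp_pd.mpr rfl).symm
    have e13 : ∃ u ∈ f1 T1 T2 '' S1, ∃ v ∈ f2 T1 T2 '' S3, (DG T1 T2).Adj u v := by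
      refine ⟨_, ⟨_, ml, rfl⟩, _, ⟨_, ql, rfl⟩, ?_⟩
      rw [← al, ← f2_leaf, bl]
      exact f2_adj T1 T2 (adj_sp_sp.mpr (by omega))
    intro a b hab
    fin_cases a <;> fin_cases b <;>
      first
      | exact absurd hab (by decide)
      | exact e01
      | exact e23
      | exact e02
      | exact e03
      | exact e12
      | exact e13

lemma delta_upper (n : ℕ) (hn : 4 ≤ n) : DeltaTW n ≤ n - 3 - (Nat.sqrt (n - 2) - 1) / 2 := by
  unfold DeltaTW
  apply csSup_le'
  rintro k ⟨X, V1, V2, T1, T2, hX, rfl⟩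
  subst hX
  exact dtw_upper T1 T2 hn

lemma delta_lower (n : ℕ) (hn : 4 ≤ n) (l : ℕ) (T1 T2 : PhyloTree (CatV n) (Fin n))
    (h : ∀ k, HasTreeDecompWidthLE (DG T1 T2) k → l + 2 ≤ k) : l ≤ DeltaTW n := by
  have hX : Nat.card (Fin n) = n := by simp
  obtain ⟨κ, -, -, htd⟩ := td_upper T1 T2 (by rw [hX]; exact hn)
  have htw : l + 2 ≤ treewidth (DG T1 T2) := le_csInf ⟨_, htd⟩ h
  have hl : l ≤ dtw T1 T2 := by
    unfold dtw
    change l ≤ treewidth (DG T1 T2) - 2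
    omega
  refine hl.trans (le_csSup ?_ ⟨Fin n, CatV n, CatV n, T1, T2, hX, rfl⟩)
  refine ⟨n - 3 - (Nat.sqrt (n - 2) - 1) / 2, ?_⟩
  rintro k ⟨X, V1, V2, S1, S2, hX', rfl⟩
  have := dtw_upper S1 S2 (by rw [hX']; exact hn)
  rw [hX'] at this
  exact this

end DTW

theorem DeltaTW_linear :
    (∃ c1 c2 : ℝ, 0 < c1 ∧ 0 < c2 ∧ ∀ n : ℕ, 4 ≤ n →
      c1 * n ≤ (DeltaTW n : ℝ) ∧ (DeltaTW n : ℝ) ≤ c2 * n) ∧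
    (∀ n : ℕ, 4 ≤ n → DeltaTW n ≤ n - 3 - (Nat.sqrt (n - 2) - 1) / 2) := by
  refine ⟨⟨1 / 5000, 1, by norm_num, by norm_num, fun n hn => ⟨?_, ?_⟩⟩, DTW.delta_upper⟩
  · have key : n ≤ 5000 * DeltaTW n := by
      by_cases hs : n ≤ 5000
      · obtain ⟨T1, T2, h⟩ := DTW.lower_small n hn
        have := DTW.delta_lower n hn 1 T1 T2 h
        omega
      · obtain ⟨T1, T2, h⟩ := DTW.lower_big n (n / 101) hn (by omega) (by omega)
        have := DTW.delta_lower n hn (n / 101 / 8 - 2) T1 T2 (fun k hk => by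
          have := h k hk
          omega)
        omega
    have : (n : ℝ) ≤ 5000 * (DeltaTW n : ℝ) := by exact_mod_cast key
    linarith
  · have := DTW.delta_upper n hn
    rw [one_mul]
    exact_mod_cast (by omega : DeltaTW n ≤ n)
end

section
/- Let N = (V,E) be an unrooted binary phylogenetic network and T an unrooted binary phylogenetic tree, both on the same label set X with |X| ≥ 3. If N displays T then tw(D(N,T)) ≤ r(N) + 2, where r(N) = |E| − (|V| − 1) is the reticulation number of N. Moreover this bound is sharp: if N = T then r(N) = 0 and tw(D(N,T)) = 2. -/
open SimpleGraph

/-- The graph obtained from `H` by suppressing all its degree-2 vertices: its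
vertices are the vertices of `H` of degree other than 2, two of them being
adjacent iff they are joined in `H` by a path all of whose internal vertices
have degree 2. -/
def Smoothing {W : Type*} (H : SimpleGraph W) :
    SimpleGraph {w : W // (H.neighborSet w).ncard ≠ 2} :=
  SimpleGraph.fromRel (fun a b =>
    ∃ p : H.Walk a.1 b.1, p.IsPath ∧
      ∀ x ∈ p.support, x = a.1 ∨ x = b.1 ∨ (H.neighborSet x).ncard = 2)

/-- The network `N` displays the tree `T`: `N` has a subgraph which is a
subdivision of `T` (i.e. a connected subgraph which, after suppressing its
degree-2 vertices, is label-preservingly isomorphic to `T`). -/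
def Displays {V W X : Type*} (N : PhyloGraph V X) (T : PhyloTree W X) : Prop :=
  ∃ S : N.graph.Subgraph, S.coe.Connected ∧
    ∃ e : Smoothing S.coe ≃g T.graph,
      ∀ x : X, ((e.symm (T.leaf x)).1 : S.verts).1 = N.leaf x

/-- The reticulation number `r(N) = |E| - (|V| - 1)` of a network `N`. -/
noncomputable def reticNumber {V X : Type*} (N : PhyloGraph V X) : ℕ :=
  N.graph.edgeSet.ncard - (Nat.card V - 1)

theorem parent_exists {V : Type*} (G : SimpleGraph V) (A : Set V)
    (h : ∀ v, ∃ a ∈ A, G.Reachable v a) :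
    ∃ (p : V → V) (d : V → ℕ), ∀ v, (v ∈ A → p v = v ∧ d v = 0) ∧
      (v ∉ A → G.Adj v (p v) ∧ d (p v) + 1 = d v) := by
  classical
  have hex : ∀ v, ∃ n, ∃ a ∈ A, ∃ w : G.Walk v a, w.length = n := by
    intro v
    obtain ⟨a, ha, ⟨w⟩⟩ := h v
    exact ⟨_, a, ha, w, rfl⟩
  let d : V → ℕ := fun v => Nat.find (hex v)
  have hd : ∀ v, ∃ a ∈ A, ∃ w : G.Walk v a, w.length = d v := fun v => Nat.find_spec (hex v)
  have hmin : ∀ v a (_ : a ∈ A) (w : G.Walk v a), d v ≤ w.length :=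
    fun v a ha w => Nat.find_min' (hex v) ⟨a, ha, w, rfl⟩
  have key : ∀ v, ∃ u, (v ∈ A → u = v ∧ d v = 0) ∧ (v ∉ A → G.Adj v u ∧ d u + 1 = d v) := by
    intro v
    by_cases hv : v ∈ A
    · refine ⟨v, fun _ => ⟨rfl, ?_⟩, fun h => absurd hv h⟩
      have := hmin v v hv Walk.nil
      simpa using this
    · obtain ⟨a, ha, w, hw⟩ := hd v
      cases w with
      | nil => exact absurd ha hv
      | @cons _ u _ hadj w' =>
        refine ⟨u, fun h => absurd h hv, fun _ => ⟨hadj, ?_⟩⟩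
        have h1 := hmin u a ha w'
        obtain ⟨b, hb, w2, hw2⟩ := hd u
        have h2 := hmin v b hb (Walk.cons hadj w2)
        simp only [Walk.length_cons] at hw h2
        omega
  choose p hp using key
  exact ⟨p, d, hp⟩

/-- Restriction of a graph to edges inside the fibres of a map. -/
def fib {V W : Type*} (G : SimpleGraph V) (f : V → W) : SimpleGraph V where
  Adj u v := G.Adj u v ∧ f u = f v
  symm := ⟨fun _ _ h => ⟨h.1.symm, h.2.symm⟩⟩
  loopless := ⟨fun _ h => G.loopless.irrefl _ h.1⟩

theorem fib_reach_eq {V W : Type*} {G : SimpleGraph V} {f : V → W} {u v : V}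
    (h : (fib G f).Reachable u v) : f u = f v := by
  obtain ⟨w⟩ := h
  induction w with
  | nil => rfl
  | cons hadj _ ih => exact hadj.2.trans ih

theorem retract_exists {V : Type*} (G : SimpleGraph V) (A : Set V)
    (h : ∀ v, ∃ a ∈ A, G.Reachable v a) :
    ∃ ρ : V → V, (∀ v, ρ v ∈ A) ∧ (∀ a ∈ A, ρ a = a) ∧
      ∀ v, (fib G ρ).Reachable v (ρ v) := by
  obtain ⟨p, d, hp⟩ := parent_exists G A h
  let ρ : V → V := fun v => p^[d v] v
  have hA : ∀ a ∈ A, ρ a = a := by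
    intro a ha
    simp [ρ, ((hp a).1 ha).2]
  have hstep : ∀ v, v ∉ A → ρ (p v) = ρ v := by
    intro v hv
    simp only [ρ]
    rw [← ((hp v).2 hv).2, Function.iterate_succ_apply]
  have main : ∀ n v, d v = n → ρ v ∈ A ∧ (fib G ρ).Reachable v (ρ v) := by
    intro n
    induction n with
    | zero =>
      intro v hv
      have : v ∈ A := by
        by_contra hc
        have := ((hp v).2 hc).2
        omega
      rw [hA v this]
      exact ⟨this, Reachable.refl _⟩
    | succ n ih =>
      intro v hv
      have hc : v ∉ A := by
        intro hc
        have := ((hp v).1 hc).2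
        omega
      have h1 := (hp v).2 hc
      have h2 := ih (p v) (by omega)
      rw [hstep v hc] at h2
      refine ⟨h2.1, Reachable.trans (Adj.reachable ?_) h2.2⟩
      exact ⟨h1.1, (hstep v hc).symm⟩
  exact ⟨ρ, fun v => (main _ v rfl).1, hA, fun v => (main _ v rfl).2⟩

theorem parent_edge_inj {V : Type*} (q : V → V) (h : V → ℕ) (r : V)
    (hq : ∀ i, i ≠ r → h (q i) < h i) :
    Set.InjOn (fun i => s(i, q i)) {i | i ≠ r} := by
  intro i hi j hj hij
  simp only [Sym2.eq_iff] at hij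
  rcases hij with ⟨h1, _⟩ | ⟨h1, h2⟩
  · exact h1
  · have a := hq i hi
    have b := hq j hj
    rw [h2] at a
    rw [← h1] at b
    omega

theorem parent_edge_ncard {V : Type*} [Finite V] (q : V → V) (h : V → ℕ) (r : V)
    (hq : ∀ i, i ≠ r → h (q i) < h i) :
    ((fun i => s(i, q i)) '' {i | i ≠ r}).ncard + 1 = Nat.card V := by
  rw [(parent_edge_inj q h r hq).ncard_image]
  have : {i | i ≠ r} = ({r} : Set V)ᶜ := by ext; simp
  rw [this]
  have := Set.ncard_add_ncard_compl ({r} : Set V)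
  rw [Set.ncard_singleton] at this
  omega

theorem tree_parent {V : Type*} [Finite V] (G : SimpleGraph V) (hG : G.IsTree) (r : V) :
    ∃ (q : V → V) (d : V → ℕ), q r = r ∧ (∀ v, v ≠ r → G.Adj v (q v) ∧ d (q v) + 1 = d v) ∧
      ∀ u v, G.Adj u v → (u ≠ r ∧ q u = v) ∨ (v ≠ r ∧ q v = u) := by
  obtain ⟨q, d, hq⟩ := parent_exists G {r} (fun v => ⟨r, rfl, hG.connected.preconnected v r⟩)
  refine ⟨q, d, ((hq r).1 rfl).1, fun v hv => (hq v).2 hv, ?_⟩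
  have h1 := parent_edge_ncard q d r (fun i hi => by have := ((hq i).2 hi).2; omega)
  have h2 := (isTree_iff_connected_and_card.1 hG).2
  have hsub : (fun i => s(i, q i)) '' {i | i ≠ r} ⊆ G.edgeSet := by
    rintro _ ⟨i, hi, rfl⟩
    exact ((hq i).2 hi).1
  have heq : (fun i => s(i, q i)) '' {i | i ≠ r} = G.edgeSet := by
    apply Set.eq_of_subset_of_ncard_le hsub _ (Set.toFinite _)
    have : G.edgeSet.ncard = Nat.card G.edgeSet := rfl
    omega
  intro u v huv
  have : s(u, v) ∈ G.edgeSet := huv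
  rw [← heq] at this
  obtain ⟨i, hi, he⟩ := this
  simp only [Sym2.eq_iff] at he
  rcases he with ⟨rfl, h⟩ | ⟨rfl, h⟩
  · exact Or.inl ⟨hi, h⟩
  · exact Or.inr ⟨hi, h⟩

/-- The graph of a parent function. -/
def ptree {V : Type*} (q : V → V) (r : V) : SimpleGraph V :=
  SimpleGraph.fromRel (fun i j => i ≠ r ∧ q i = j)

theorem ptree_adj {V : Type*} (q : V → V) (h : V → ℕ) (r : V)
    (hq : ∀ i, i ≠ r → h (q i) < h i) (i : V) (hi : i ≠ r) : (ptree q r).Adj i (q i) := by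
  rw [ptree, fromRel_adj]
  refine ⟨?_, Or.inl ⟨hi, rfl⟩⟩
  intro hc
  have := hq i hi
  rw [← hc] at this
  omega

theorem ptree_conn_set {V : Type*} (q : V → V) (h : V → ℕ) (r : V)
    (hq : ∀ i, i ≠ r → h (q i) < h i) (I : Set V) (t : V) (ht : t ∈ I)
    (hI : ∀ i ∈ I, i ≠ t → i ≠ r ∧ q i ∈ I) : ((ptree q r).induce I).Connected := by
  rw [connected_iff_exists_forall_reachable]
  refine ⟨⟨t, ht⟩, ?_⟩
  have : ∀ n, ∀ i (hi : i ∈ I), h i = n → ((ptree q r).induce I).Reachable ⟨t, ht⟩ ⟨i, hi⟩ := by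
    intro n
    induction n using Nat.strong_induction_on with
    | _ n ih =>
      intro i hi hn
      by_cases hit : i = t
      · subst hit; exact Reachable.refl _
      · obtain ⟨h1, h2⟩ := hI i hi hit
        refine (ih (h (q i)) (by have := hq i h1; omega) (q i) h2 rfl).trans (Adj.reachable ?_)
        exact (ptree_adj q h r hq i h1).symm
  exact fun w => this _ w.1 w.2 rfl

theorem ptree_isTree {V : Type*} [Finite V] (q : V → V) (h : V → ℕ) (r : V)
    (hq : ∀ i, i ≠ r → h (q i) < h i) : (ptree q r).IsTree := by
  rw [isTree_iff_connected_and_card]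
  constructor
  · have := ptree_conn_set q h r hq Set.univ r trivial (fun i _ hi => ⟨hi, trivial⟩)
    exact (induceUnivIso _).connected_iff.1 this
  · rw [← parent_edge_ncard q h r hq]
    have : (ptree q r).edgeSet = (fun i => s(i, q i)) '' {i | i ≠ r} := by
      ext e
      induction e using Sym2.ind with
      | _ a b =>
        constructor
        · intro hab
          rw [mem_edgeSet, ptree, fromRel_adj] at hab
          rcases hab.2 with ⟨h1, h2⟩ | ⟨h1, h2⟩
          · exact ⟨a, h1, by simp [h2]⟩
          · exact ⟨b, h1, by simp [h2]⟩
        · rintro ⟨i, hi, he⟩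
          simp only at he
          rw [← he, mem_edgeSet]
          exact ptree_adj q h r hq i hi
    rw [← this]
    rfl

theorem td_of_tree {ι V : Type*} [Finite ι] (t : SimpleGraph ι) (ht : t.IsTree)
    (G : SimpleGraph V) (bag : ι → Finset V) (k : ℕ)
    (h1 : ∀ v : V, ∃ i, v ∈ bag i)
    (h2 : ∀ u v : V, G.Adj u v → ∃ i, u ∈ bag i ∧ v ∈ bag i)
    (h3 : ∀ v : V, (t.induce {i | v ∈ bag i}).Connected)
    (h4 : ∀ i, (bag i).card ≤ k + 1) : HasTreeDecompWidthLE G k := by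
  have hne : Nonempty ι := ht.connected.nonempty
  obtain ⟨n, hn⟩ : ∃ n, Nat.card ι = n + 1 := ⟨Nat.card ι - 1, by
    have := Nat.card_pos (α := ι); omega⟩
  let e : ι ≃ Fin (n + 1) := Finite.equivFinOfCardEq hn
  let t' : SimpleGraph (Fin (n + 1)) := t.comap e.symm
  let f : t' ≃g t := ⟨e.symm, Iff.rfl⟩
  refine ⟨n, t', fun i => bag (e.symm i), f.isTree_iff.2 ht, ?_, ?_, ?_, fun i => h4 _⟩
  · intro v
    obtain ⟨i, hi⟩ := h1 v
    exact ⟨e i, by simpa using hi⟩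
  · intro u v huv
    obtain ⟨i, hi⟩ := h2 u v huv
    exact ⟨e i, by simpa using hi⟩
  · intro v
    let g : t'.induce {i | v ∈ bag (e.symm i)} ≃g t.induce {i | v ∈ bag i} :=
      { toFun := fun i => ⟨e.symm i.1, i.2⟩
        invFun := fun i => ⟨e i.1, by
          change v ∈ bag (e.symm (e i.1))
          rw [e.symm_apply_apply]
          exact i.2⟩
        left_inv := fun i => by simp
        right_inv := fun i => by simp
        map_rel_iff' := Iff.rfl }
    exact g.connected_iff.2 (h3 v)

/-- Lower bound: a graph with minimum degree two has no decomposition of width one. -/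
theorem no_td_one {V : Type*} [Finite V] [Nonempty V] (G : SimpleGraph V)
    (hdeg : ∀ v, ∃ a b, a ≠ b ∧ G.Adj v a ∧ G.Adj v b) (k : ℕ)
    (htd : HasTreeDecompWidthLE G k) : 2 ≤ k := by
  classical
  obtain ⟨n, t, bag, ht, hv, he, hc, hcard⟩ := htd
  obtain ⟨q, d, hq0, hq, hqe⟩ := tree_parent t ht 0
  have htop : ∀ v, ∃ i, v ∈ bag i ∧ ∀ j, v ∈ bag j → d i ≤ d j := by
    intro v
    obtain ⟨i, hi, hm⟩ := Set.exists_min_image {i | v ∈ bag i} d (Set.toFinite _) (hv v)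
    exact ⟨i, hi, hm⟩
  choose top htop1 htop2 using htop
  have hup : ∀ v i, v ∈ bag i → i ≠ top v → i ≠ 0 ∧ v ∈ bag (q i) := by
    intro v i hi hit
    let D : Set (Fin (n + 1)) := {j | ∃ m, q^[m] j = i}
    have hdepth : ∀ m j, d (q^[m] j) ≤ d j ∧ (q^[m] j ≠ j → d (q^[m] j) < d j) := by
      intro m
      induction m with
      | zero => intro j; simp
      | succ m ih =>
        intro j
        rw [Function.iterate_succ_apply]
        by_cases hj : j = 0
        · rw [hj, hq0]; exact ih 0
        · have := (hq j hj).2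
          have := (ih (q j)).1
          omega
    have htD : top v ∉ D := by
      rintro ⟨m, hm⟩
      have h1 := (hdepth m (top v)).2 (by rw [hm]; exact hit)
      rw [hm] at h1
      have := htop2 v i hi
      omega
    obtain ⟨w⟩ := (hc v).preconnected ⟨i, hi⟩ ⟨top v, htop1 v⟩
    obtain ⟨a, -, ha1, ha2⟩ := w.exists_boundary_dart (Subtype.val ⁻¹' D) ⟨0, rfl⟩ htD
    have hadj : t.Adj a.fst.1 a.snd.1 := a.adj
    have ha3 : v ∈ bag a.snd.1 := a.snd.2
    rcases hqe _ _ hadj with ⟨h1, h2⟩ | ⟨h1, h2⟩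
    · obtain ⟨m, hm⟩ := ha1
      cases m with
      | zero =>
        simp only [Function.iterate_zero, id] at hm
        rw [← hm, h2]
        exact ⟨h1, ha3⟩
      | succ m =>
        rw [Function.iterate_succ_apply, h2] at hm
        exact absurd ⟨m, hm⟩ ha2
    · obtain ⟨m, hm⟩ := ha1
      exact absurd ⟨m + 1, by rw [Function.iterate_succ_apply, h2]; exact hm⟩ ha2
  obtain ⟨v, -, hvmax⟩ := Set.exists_max_image (Set.univ : Set V) (fun v => d (top v))
    (Set.toFinite _) Set.univ_nonempty
  have hnb : ∀ u, G.Adj v u → u ∈ bag (top v) := by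
    intro u huv
    obtain ⟨i, hi, hm⟩ := Set.exists_min_image {i | v ∈ bag i ∧ u ∈ bag i} d (Set.toFinite _)
      (he v u huv)
    by_cases hit : i = top v
    · rw [← hit]; exact hi.2
    · obtain ⟨h1, h2⟩ := hup v i hi.1 hit
      have h3 := (hq i h1).2
      have h4 := htop2 v _ h2
      have h5 := hvmax u trivial
      have h6 : i ≠ top u := by
        rintro rfl
        omega
      have h7 := hup u i hi.2 h6
      have := hm _ ⟨h2, h7.2⟩
      omega
  obtain ⟨a, b, hab, ha, hb⟩ := hdeg v
  have hsub : ({v, a, b} : Finset V) ⊆ bag (top v) := by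
    intro x hx
    simp only [Finset.mem_insert, Finset.mem_singleton] at hx
    rcases hx with rfl | rfl | rfl
    · exact htop1 _
    · exact hnb _ ha
    · exact hnb _ hb
  have h3 : ({v, a, b} : Finset V).card = 3 := by
    rw [Finset.card_eq_three]
    exact ⟨v, a, b, ha.ne, hb.ne, hab, rfl⟩
  have := Finset.card_le_card hsub
  have := hcard (top v)
  omega

theorem core_parent {V W : Type*} [Finite V] [Finite W] (G : SimpleGraph V) (T : SimpleGraph W)
    (hT : T.IsTree) (τ : V → W) (hsurj : Function.Surjective τ)
    (hfib : ∀ u v, τ u = τ v → (fib G τ).Reachable u v)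
    (hedge : ∀ w w', T.Adj w w' → ∃ u v, G.Adj u v ∧ τ u = w ∧ τ v = w') :
    ∃ (p : V → V) (root : V) (h : V → ℕ) (s : W → V), p root = root ∧
      (∀ v, v ≠ root → G.Adj v (p v) ∧ h (p v) < h v) ∧
      (∀ v, τ v ≠ τ (p v) → v = s (τ v)) ∧ s (τ root) = root ∧ (∀ w, τ (s w) = w) ∧
      ∀ w w', T.Adj w w' → τ (p (s w)) = w' ∨ τ (p (s w')) = w := by
  classical
  obtain ⟨w0⟩ : Nonempty W := hT.connected.nonempty
  obtain ⟨q, dT, -, hq, hqe⟩ := tree_parent T hT w0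
  have hsc : ∀ w, ∃ u v, τ u = w ∧ (w = w0 → v = u) ∧ (w ≠ w0 → G.Adj u v ∧ τ v = q w) := by
    intro w
    by_cases hw : w = w0
    · obtain ⟨u, hu⟩ := hsurj w
      exact ⟨u, u, hu, fun _ => rfl, fun h => absurd hw h⟩
    · obtain ⟨u, v, h1, h2, h3⟩ := hedge _ _ (hq w hw).1
      exact ⟨u, v, h2, fun h => absurd h hw, fun _ => ⟨h1, h3⟩⟩
  choose s c hs hc0 hc1 using hsc
  obtain ⟨p', d', hp'⟩ := parent_exists (fib G τ) (Set.range s)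
    (fun v => ⟨s (τ v), ⟨_, rfl⟩, hfib _ _ (hs _).symm⟩)
  obtain ⟨M, hM⟩ : ∃ M, ∀ v, d' v < M := by
    obtain ⟨M, hM⟩ := (Set.finite_range d').bddAbove
    exact ⟨M + 1, fun v => Nat.lt_succ_of_le (hM ⟨v, rfl⟩)⟩
  let p : V → V := fun v => if v ∈ Set.range s then c (τ v) else p' v
  have hps : ∀ w, p (s w) = c w := by
    intro w
    simp only [p]
    rw [if_pos ⟨w, rfl⟩, hs]
  have hpn : ∀ v, v ∉ Set.range s → p v = p' v := fun v hv => if_neg hv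
  refine ⟨p, s w0, fun v => dT (τ v) * M + d' v, s, ?_, ?_, ?_, ?_, hs, ?_⟩
  · rw [hps, hc0 w0 rfl]
  · intro v hv
    by_cases hvs : v ∈ Set.range s
    · obtain ⟨w, rfl⟩ := hvs
      have hw : w ≠ w0 := by rintro rfl; exact hv rfl
      rw [hps]
      refine ⟨(hc1 w hw).1, ?_⟩
      simp only
      rw [(hc1 w hw).2, hs, ← (hq w hw).2]
      have := hM (c w)
      rw [Nat.add_mul]
      omega
    · rw [hpn v hvs]
      have := (hp' v).2 hvs
      refine ⟨this.1.1, ?_⟩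
      simp only
      rw [← this.1.2]
      omega
  · intro v hv
    by_cases hvs : v ∈ Set.range s
    · obtain ⟨w, rfl⟩ := hvs
      rw [hs]
    · rw [hpn v hvs] at hv
      exact absurd ((hp' v).2 hvs).1.2 hv
  · rw [hs]
  · intro w w' hww
    rcases hqe _ _ hww with ⟨h1, h2⟩ | ⟨h1, h2⟩
    · left; rw [hps, (hc1 w h1).2, h2]
    · right; rw [hps, (hc1 w' h1).2, h2]

theorem toDisplay_ext_iff {V W X : Type*} (l1 : X → V) (l2 : X → W) (y z : V ⊕ W) :
    toDisplay l1 l2 y = toDisplay l1 l2 z ↔ mergeMap l1 l2 y = mergeMap l1 l2 z :=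
  ⟨fun h => congrArg Subtype.val h, fun h => Subtype.ext h⟩

theorem toDisplay_eq_iff_inl {V W X : Type*} (l1 : X → V) (l2 : X → W) (hl2 : Function.Injective l2)
    (u : V) (y : V ⊕ W) : toDisplay l1 l2 y = toDisplay l1 l2 (Sum.inl u) ↔
      y = Sum.inl u ∨ ∃ x, l1 x = u ∧ y = Sum.inr (l2 x) := by
  classical
  rw [toDisplay_ext_iff]
  cases y with
  | inl v => simp [mergeMap]
  | inr w =>
    by_cases h : ∃ x, l2 x = w
    · obtain ⟨x, rfl⟩ := h
      have h' : ∃ x', l2 x' = l2 x := ⟨x, rfl⟩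
      have hx : h'.choose = x := hl2 h'.choose_spec
      simp only [mergeMap, dif_pos h', hx]
      constructor
      · intro h; exact Or.inr ⟨x, Sum.inl.inj h, rfl⟩
      · rintro (h | ⟨x', h1, h2⟩)
        · simp at h
        · rw [hl2 (Sum.inr.inj h2), h1]
    · simp only [mergeMap, dif_neg h]
      constructor
      · intro h; simp at h
      · rintro (h' | ⟨x', h1, h2⟩)
        · simp at h'
        · exact absurd ⟨x', (Sum.inr.inj h2).symm⟩ h

theorem toDisplay_eq_iff_inr {V W X : Type*} (l1 : X → V) (l2 : X → W)
    (w : W) (hw : ¬ ∃ x, l2 x = w) (y : V ⊕ W) :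
    toDisplay l1 l2 y = toDisplay l1 l2 (Sum.inr w) ↔ y = Sum.inr w := by
  classical
  rw [toDisplay_ext_iff]
  cases y with
  | inl v => simp [mergeMap, hw]
  | inr w' =>
    by_cases h : ∃ x, l2 x = w'
    · simp only [mergeMap, dif_pos h, dif_neg hw]
      constructor
      · intro h; simp at h
      · intro h'
        exact absurd (Sum.inr.inj h' ▸ h) hw
    · simp only [mergeMap, dif_neg h, dif_neg hw]

theorem toDisplay_inr_leaf {V W X : Type*} (l1 : X → V) (l2 : X → W) (hl2 : Function.Injective l2)
    (x : X) : toDisplay l1 l2 (Sum.inr (l2 x)) = toDisplay l1 l2 (Sum.inl (l1 x)) :=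
  (toDisplay_eq_iff_inl l1 l2 hl2 _ _).2 (Or.inr ⟨x, rfl, rfl⟩)

theorem toDisplay_cases {V W X : Type*} (l1 : X → V) (l2 : X → W)
    (z : DisplayVertex l1 l2) : (∃ v, z = toDisplay l1 l2 (Sum.inl v)) ∨
      ∃ w, (¬ ∃ x, l2 x = w) ∧ z = toDisplay l1 l2 (Sum.inr w) := by
  classical
  obtain ⟨u, hu⟩ := z
  cases u with
  | inl v => exact Or.inl ⟨v, rfl⟩
  | inr w =>
    by_cases h : ∃ x, l2 x = w
    · simp [mergeMap, h] at hu
    · exact Or.inr ⟨w, h, Subtype.ext hu.symm⟩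

theorem core_td {V W X : Type*} [Finite V] [Finite W] (G : SimpleGraph V) (T : SimpleGraph W)
    (l1 : X → V) (l2 : X → W) (hl1 : Function.Injective l1) (hl2 : Function.Injective l2)
    (hT : T.IsTree) (τ : V → W) (hsurj : Function.Surjective τ)
    (hfib : ∀ u v, τ u = τ v → (fib G τ).Reachable u v)
    (hedge : ∀ w w', T.Adj w w' → ∃ u v, G.Adj u v ∧ τ u = w ∧ τ v = w')
    (hleaf : ∀ x, τ (l1 x) = l2 x) :
    HasTreeDecompWidthLE (displayGraph G l1 T l2) (G.edgeSet.ncard - (Nat.card V - 1) + 2) := by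
  classical
  obtain ⟨p, root, h, s, hp0, hp, hτ, hs0, hs, hTe⟩ := core_parent G T hT τ hsurj hfib hedge
  -- the extra edges
  let E0 : Set (Sym2 V) := (fun i => s(i, p i)) '' {i | i ≠ root}
  have hE0 : E0.ncard + 1 = Nat.card V := parent_edge_ncard p h root (fun i hi => (hp i hi).2)
  have hE0sub : E0 ⊆ G.edgeSet := by
    rintro _ ⟨i, hi, rfl⟩
    exact (hp i hi).1
  let R : Set (Sym2 V) := G.edgeSet \ E0
  have hR : R.ncard = G.edgeSet.ncard - (Nat.card V - 1) := by
    have := Set.ncard_sdiff_add_ncard_of_subset hE0sub (Set.toFinite _)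
    change (G.edgeSet \ E0).ncard = _
    omega
  let C0 : Finset V := (Set.toFinite R).toFinset.image (fun e => (Quot.out e).1)
  have hC0 : C0.card ≤ R.ncard := by
    rw [Set.ncard_eq_toFinset_card R (Set.toFinite R)]
    exact Finset.card_image_le
  have hC0e : ∀ u v, G.Adj u v → s(u, v) ∉ E0 → u ∈ C0 ∨ v ∈ C0 := by
    intro u v huv hE
    have h1 : s(u, v) ∈ R := ⟨huv, hE⟩
    have h2 : (Quot.out s(u, v)).1 ∈ C0 :=
      Finset.mem_image.2 ⟨s(u, v), by simpa using h1, rfl⟩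
    have h3 : (Quot.out s(u, v)).1 ∈ s(u, v) := Sym2.out_fst_mem _
    rcases Sym2.mem_iff.1 h3 with h | h
    · left; rwa [h] at h2
    · right; rwa [h] at h2
  -- the rooted decomposition tree
  let q : V × Bool → V × Bool := fun i => if i.2 then (i.1, false) else (p i.1, true)
  let r : V × Bool := (root, false)
  let hh : V × Bool → ℕ := fun i => 2 * h i.1 + (if i.2 then 1 else 0)
  have hq : ∀ i, i ≠ r → hh (q i) < hh i := by
    rintro ⟨v, b⟩ hi
    cases b with
    | true => simp [q, hh]
    | false =>
      have hv : v ≠ root := by rintro rfl; exact hi rfl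
      have := (hp v hv).2
      simp only [q, hh]
      simp
      omega
  let B : V × Bool → Finset (V ⊕ W) := fun i =>
    if i.2 then {Sum.inl i.1, Sum.inr (τ (p i.1)), Sum.inr (τ i.1)}
    else {Sum.inl i.1, Sum.inl (p i.1), Sum.inr (τ (p i.1))}
  have hBcard : ∀ i, (B i).card ≤ 3 := by
    rintro ⟨v, b⟩
    cases b
    · exact Finset.card_le_three
    · exact Finset.card_le_three
  have hBl1 : ∀ u v, Sum.inl u ∈ B (v, true) ↔ u = v := by intro u v; simp [B]
  have hBl0 : ∀ u v, Sum.inl u ∈ B (v, false) ↔ u = v ∨ u = p v := by intro u v; simp [B]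
  have hBr1 : ∀ w v, Sum.inr w ∈ B (v, true) ↔ w = τ (p v) ∨ w = τ v := by intro w v; simp [B]
  have hBr0 : ∀ w v, Sum.inr w ∈ B (v, false) ↔ w = τ (p v) := by intro u v; simp [B]
  have hq1 : ∀ v, q (v, true) = (v, false) := fun v => rfl
  have hq0 : ∀ v, q (v, false) = (p v, true) := fun v => rfl
  have hconl : ∀ u, ((ptree q r).induce {i | Sum.inl u ∈ B i}).Connected := by
    intro u
    refine ptree_conn_set q hh r hq _ (u, false) ((hBl0 u u).2 (Or.inl rfl)) ?_
    rintro ⟨v, b⟩ hi hne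
    simp only [Set.mem_ofPred_eq] at hi ⊢
    cases b with
    | true =>
      rw [hBl1] at hi
      subst hi
      refine ⟨by simp [r], ?_⟩
      rw [hq1, hBl0]; exact Or.inl rfl
    | false =>
      rw [hBl0] at hi
      rcases hi with rfl | hi
      · exact absurd rfl hne
      · refine ⟨?_, ?_⟩
        · intro hc
          have hv : v = root := congrArg Prod.fst hc
          apply hne
          rw [hi, hv, hp0]
        · rw [hq0, hBl1]; exact hi
  have hconr : ∀ w, ((ptree q r).induce {i | Sum.inr w ∈ B i}).Connected := by
    intro w
    by_cases hw : w = τ root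
    · refine ptree_conn_set q hh r hq _ r ((hBr0 w root).2 (by rw [hp0]; exact hw)) ?_
      rintro ⟨v, b⟩ hi hne
      simp only [Set.mem_ofPred_eq] at hi ⊢
      refine ⟨hne, ?_⟩
      cases b with
      | true =>
        rw [hBr1] at hi
        rw [hq1, hBr0]
        rcases hi with hi | hi
        · exact hi
        · by_contra hc
          have h1 := hτ v (by rw [← hi]; exact hc)
          rw [← hi, hw, hs0] at h1
          rw [h1, hp0] at hc
          exact hc hw
      | false =>
        rw [hBr0] at hi
        rw [hq0, hBr1]
        exact Or.inr hi
    · refine ptree_conn_set q hh r hq _ (s w, true) ((hBr1 w _).2 (Or.inr (hs w).symm)) ?_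
      rintro ⟨v, b⟩ hi hne
      simp only [Set.mem_ofPred_eq] at hi ⊢
      cases b with
      | true =>
        refine ⟨by simp [r], ?_⟩
        rw [hBr1] at hi
        rw [hq1, hBr0]
        rcases hi with hi | hi
        · exact hi
        · by_contra hc
          have h1 := hτ v (by rw [← hi]; exact hc)
          rw [← hi] at h1
          exact hne (by rw [h1])
      | false =>
        rw [hBr0] at hi
        rw [hq0, hBr1]
        refine ⟨?_, Or.inr hi⟩
        intro hc
        have hv : v = root := congrArg Prod.fst hc
        rw [hv, hp0] at hi
        exact hw hi
  let C : Finset (DisplayVertex l1 l2) := C0.image (fun v => toDisplay l1 l2 (Sum.inl v))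
  let bag : V × Bool → Finset (DisplayVertex l1 l2) := fun i =>
    (B i).image (toDisplay l1 l2) ∪ C
  have hbag : ∀ y i, y ∈ B i → toDisplay l1 l2 y ∈ bag i := fun y i hy =>
    Finset.mem_union_left _ (Finset.mem_image_of_mem _ hy)
  have hvc : ∀ z : DisplayVertex l1 l2, ∃ i, z ∈ bag i := by
    intro z
    rcases toDisplay_cases l1 l2 z with ⟨v, rfl⟩ | ⟨w, -, rfl⟩
    · exact ⟨(v, true), hbag _ _ ((hBl1 _ _).2 rfl)⟩
    · exact ⟨(s w, true), hbag _ _ ((hBr1 _ _).2 (Or.inr (hs w).symm))⟩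
  have hGe : ∀ u v, G.Adj u v → ∃ i, toDisplay l1 l2 (Sum.inl u) ∈ bag i ∧
      toDisplay l1 l2 (Sum.inl v) ∈ bag i := by
    intro u v huv
    by_cases hE : s(u, v) ∈ E0
    · obtain ⟨i, -, hi⟩ := hE
      simp only [Sym2.eq_iff] at hi
      rcases hi with ⟨rfl, rfl⟩ | ⟨rfl, rfl⟩
      · exact ⟨(i, false), hbag _ _ ((hBl0 _ _).2 (Or.inl rfl)),
          hbag _ _ ((hBl0 _ _).2 (Or.inr rfl))⟩
      · exact ⟨(i, false), hbag _ _ ((hBl0 _ _).2 (Or.inr rfl)),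
          hbag _ _ ((hBl0 _ _).2 (Or.inl rfl))⟩
    · rcases hC0e u v huv hE with hC | hC
      · obtain ⟨i, hi⟩ := hvc (toDisplay l1 l2 (Sum.inl v))
        exact ⟨i, Finset.mem_union_right _ (Finset.mem_image.2 ⟨u, hC, rfl⟩), hi⟩
      · obtain ⟨i, hi⟩ := hvc (toDisplay l1 l2 (Sum.inl u))
        exact ⟨i, hi, Finset.mem_union_right _ (Finset.mem_image.2 ⟨v, hC, rfl⟩)⟩
  have hTe' : ∀ u v, T.Adj u v → ∃ i, toDisplay l1 l2 (Sum.inr u) ∈ bag i ∧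
      toDisplay l1 l2 (Sum.inr v) ∈ bag i := by
    intro u v huv
    rcases hTe u v huv with h1 | h1
    · exact ⟨(s u, true), hbag _ _ ((hBr1 _ _).2 (Or.inr (hs u).symm)),
        hbag _ _ ((hBr1 _ _).2 (Or.inl h1.symm))⟩
    · exact ⟨(s v, true), hbag _ _ ((hBr1 _ _).2 (Or.inl h1.symm)),
        hbag _ _ ((hBr1 _ _).2 (Or.inr (hs v).symm))⟩
  have htree : (ptree q r).IsTree := ptree_isTree q hh r hq
  refine td_of_tree (ptree q r) htree _ bag _ hvc ?_ ?_ ?_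
  · intro a b hab
    rw [displayGraph, fromRel_adj] at hab
    rcases hab.2 with (⟨u, v, huv, rfl, rfl⟩ | ⟨u, v, huv, rfl, rfl⟩) |
      (⟨u, v, huv, rfl, rfl⟩ | ⟨u, v, huv, rfl, rfl⟩)
    · exact hGe u v huv
    · exact hTe' u v huv
    · exact hGe v u huv.symm
    · exact hTe' v u huv.symm
  · intro z
    by_cases hzC : z ∈ C
    · have : {i | z ∈ bag i} = Set.univ := by
        ext i
        simp only [Set.mem_ofPred_eq, Set.mem_univ, iff_true]
        exact Finset.mem_union_right _ hzC
      rw [this]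
      exact (induceUnivIso _).connected_iff.2 htree.connected
    have hmem : ∀ i, z ∈ bag i ↔ ∃ y ∈ B i, toDisplay l1 l2 y = z := by
      intro i
      simp only [bag, Finset.mem_union, Finset.mem_image, hzC, or_false]
    rcases toDisplay_cases l1 l2 z with ⟨u, rfl⟩ | ⟨w, hw, rfl⟩
    · by_cases hu : ∃ x, l1 x = u
      · obtain ⟨x, rfl⟩ := hu
        have : {i | toDisplay l1 l2 (Sum.inl (l1 x)) ∈ bag i} =
            {i | Sum.inl (l1 x) ∈ B i} ∪ {i | Sum.inr (l2 x) ∈ B i} := by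
          ext i
          simp only [Set.mem_ofPred_eq, Set.mem_union]
          rw [hmem]
          constructor
          · rintro ⟨y, hy, he⟩
            rcases (toDisplay_eq_iff_inl l1 l2 hl2 _ _).1 he with rfl | ⟨x', hx', rfl⟩
            · exact Or.inl hy
            · rw [hl1 hx'] at hy; exact Or.inr hy
          · rintro (hy | hy)
            · exact ⟨_, hy, rfl⟩
            · exact ⟨_, hy, toDisplay_inr_leaf l1 l2 hl2 x⟩
        rw [this]
        refine induce_union_connected (hconl _).preconnected (hconr _).preconnected
          ⟨(l1 x, true), (hBl1 _ _).2 rfl, (hBr1 _ _).2 (Or.inr (hleaf x).symm)⟩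
      · have : {i | toDisplay l1 l2 (Sum.inl u) ∈ bag i} = {i | Sum.inl u ∈ B i} := by
          ext i
          simp only [Set.mem_ofPred_eq]
          rw [hmem]
          constructor
          · rintro ⟨y, hy, he⟩
            rcases (toDisplay_eq_iff_inl l1 l2 hl2 _ _).1 he with rfl | ⟨x', hx', rfl⟩
            · exact hy
            · exact absurd ⟨x', hx'⟩ hu
          · intro hy
            exact ⟨_, hy, rfl⟩
        rw [this]
        exact hconl u
    · have : {i | toDisplay l1 l2 (Sum.inr w) ∈ bag i} = {i | Sum.inr w ∈ B i} := by
        ext i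
        simp only [Set.mem_ofPred_eq]
        rw [hmem]
        constructor
        · rintro ⟨y, hy, he⟩
          rw [(toDisplay_eq_iff_inr l1 l2 w hw _).1 he] at hy
          exact hy
        · intro hy
          exact ⟨_, hy, rfl⟩
      rw [this]
      exact hconr w
  · intro i
    have h1 : (bag i).card ≤ ((B i).image (toDisplay l1 l2)).card + C.card :=
      Finset.card_union_le _ _
    have h2 : ((B i).image (toDisplay l1 l2)).card ≤ (B i).card := Finset.card_image_le
    have h3 : C.card ≤ C0.card := Finset.card_image_le
    have h4 := hBcard i
    omega

theorem smooth_edge {V : Type*} [Finite V] (S : SimpleGraph V) (τ : V → V)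
    (hτA : ∀ a, (S.neighborSet a).ncard ≠ 2 → τ a = a)
    (hτm : ∀ v, (S.neighborSet (τ v)).ncard ≠ 2)
    (hreach : ∀ v, (fib S τ).Reachable v (τ v)) (a b : V) (hab : a ≠ b)
    (ha : (S.neighborSet a).ncard ≠ 2) (hb : (S.neighborSet b).ncard ≠ 2)
    (p : S.Walk a b) (hp : p.IsPath)
    (hdeg : ∀ x ∈ p.support, x = a ∨ x = b ∨ (S.neighborSet x).ncard = 2) :
    ∃ u v, S.Adj u v ∧ τ u = a ∧ τ v = b := by
  classical
  have hex : ∃ i, τ (p.getVert i) ≠ a := ⟨p.length, by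
    rw [Walk.getVert_length, hτA b hb]; exact hab.symm⟩
  let m := Nat.find hex
  have hm : τ (p.getVert m) ≠ a := Nat.find_spec hex
  have hmin : ∀ j, j < m → τ (p.getVert j) = a := fun j hj => not_not.1 (Nat.find_min hex hj)
  have hmL : m ≤ p.length := Nat.find_min' hex (by
    rw [Walk.getVert_length, hτA b hb]; exact hab.symm)
  have hm0 : m ≠ 0 := by
    intro h0
    rw [h0, Walk.getVert_zero, hτA a ha] at hm
    exact hm rfl
  obtain ⟨k, hk⟩ := Nat.exists_eq_succ_of_ne_zero hm0
  refine ⟨p.getVert k, p.getVert m, ?_, hmin k (by omega), ?_⟩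
  · rw [hk]; exact p.adj_getVert_succ (by omega)
  by_contra hc
  have hinj := hp.getVert_injOn
  let Q : Set V := {x | ∃ i, m ≤ i ∧ i < p.length ∧ p.getVert i = x}
  have hmlt : m < p.length := by
    rcases Nat.lt_or_ge m p.length with h | h
    · exact h
    · have : m = p.length := by omega
      rw [this, Walk.getVert_length, hτA b hb] at hc
      exact absurd rfl hc
  have hint : ∀ i, 0 < i → i < p.length → (S.neighborSet (p.getVert i)).ncard = 2 := by
    intro i h1 h2
    rcases hdeg _ (p.getVert_mem_support i) with h | h | h
    · rw [hp.getVert_eq_start_iff (by omega)] at h; omega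
    · rw [hp.getVert_eq_end_iff (by omega)] at h; omega
    · exact h
  have hnbr : ∀ i, 0 < i → i < p.length → ∀ y, S.Adj (p.getVert i) y →
      y = p.getVert (i - 1) ∨ y = p.getVert (i + 1) := by
    intro i h1 h2 y hy
    have hne : p.getVert (i - 1) ≠ p.getVert (i + 1) := by
      intro h
      have := hinj (by simp; omega) (by simp; omega) h
      omega
    have hsub : ({p.getVert (i - 1), p.getVert (i + 1)} : Set V) ⊆ S.neighborSet (p.getVert i) := by
      rintro x (rfl | rfl)
      · have := p.adj_getVert_succ (i := i - 1) (by omega)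
        rw [Nat.sub_add_cancel h1] at this
        exact this.symm
      · exact p.adj_getVert_succ h2
    have heq := Set.eq_of_subset_of_ncard_le hsub
      (by rw [hint i h1 h2, Set.ncard_pair hne]) (Set.toFinite _)
    have : y ∈ S.neighborSet (p.getVert i) := hy
    rw [← heq] at this
    exact this
  have hend : τ (p.getVert m) ∉ Q := by
    rintro ⟨i, h1, h2, h3⟩
    apply hτm (p.getVert m)
    rw [← h3]
    exact hint i (by omega) h2
  obtain ⟨w⟩ := hreach (p.getVert m)
  obtain ⟨d, hd, hd1, hd2⟩ := w.exists_boundary_dart Q ⟨m, le_refl _, hmlt, rfl⟩ hend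
  have hds : τ d.snd = τ (p.getVert m) :=
    (fib_reach_eq ⟨w.takeUntil d.snd (w.dart_snd_mem_support_of_mem_darts hd)⟩).symm
  obtain ⟨i, h1, h2, h3⟩ := hd1
  have hadj : S.Adj (p.getVert i) d.snd := by rw [h3]; exact d.adj.1
  rcases hnbr i (by omega) h2 _ hadj with h | h
  · rcases Nat.lt_or_ge (i - 1) m with h' | h'
    · rw [h, hmin _ h'] at hds
      exact hm hds.symm
    · exact hd2 ⟨i - 1, h', by omega, h.symm⟩
  · rcases Nat.lt_or_ge (i + 1) p.length with h' | h'
    · exact hd2 ⟨i + 1, by omega, h', h.symm⟩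
    · have : i + 1 = p.length := by omega
      rw [h, this, Walk.getVert_length, hτA b hb] at hds
      exact hc hds.symm

theorem fib_mono_reach {V V' W W' : Type*} {G : SimpleGraph V} {G' : SimpleGraph V'} {f : V → W}
    {f' : V' → W'} (φ : V → V') (hφ : ∀ u v, G.Adj u v → f u = f v →
      G'.Adj (φ u) (φ v) ∧ f' (φ u) = f' (φ v)) {u v : V}
    (h : (fib G f).Reachable u v) : (fib G' f').Reachable (φ u) (φ v) :=
  h.map (⟨φ, fun {a b} hab => hφ a b hab.1 hab.2⟩ : fib G f →g fib G' f')

theorem displays_map {V W X : Type*} (N : PhyloGraph V X) (T : PhyloTree W X)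
    (hdisp : Displays N T) : ∃ τ : V → W, Function.Surjective τ ∧
      (∀ u v, τ u = τ v → (fib N.graph τ).Reachable u v) ∧
      (∀ w w', T.graph.Adj w w' → ∃ u v, N.graph.Adj u v ∧ τ u = w ∧ τ v = w') ∧
      ∀ x, τ (N.leaf x) = T.leaf x := by
  classical
  obtain ⟨S, hS, e, he⟩ := hdisp
  have := N.finite
  obtain ⟨w0⟩ : Nonempty W := T.connected.nonempty
  let A : Set S.verts := {a | (S.coe.neighborSet a).ncard ≠ 2}
  obtain ⟨ρ, hρ1, hρ2, hρ3⟩ := retract_exists S.coe A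
    (fun v => ⟨(e.symm w0).1, (e.symm w0).2, hS.preconnected _ _⟩)
  obtain ⟨σ, hσ1, hσ2, hσ3⟩ := retract_exists N.graph S.verts
    (fun v => ⟨(e.symm w0).1.1, (e.symm w0).1.2, N.connected.preconnected _ _⟩)
  let σ' : V → S.verts := fun v => ⟨σ v, hσ1 v⟩
  have hσ' : ∀ a : S.verts, σ' a.1 = a := fun a => Subtype.ext (hσ2 a.1 a.2)
  let g : S.verts → W := fun a => e ⟨ρ a, hρ1 a⟩
  have hg : ∀ w, g (e.symm w).1 = w := by
    intro w
    have : (⟨ρ (e.symm w).1, hρ1 _⟩ : {a // (S.coe.neighborSet a).ncard ≠ 2}) = e.symm w :=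
      Subtype.ext (hρ2 _ (e.symm w).2)
    change e ⟨ρ (e.symm w).1, hρ1 _⟩ = w
    rw [this, e.apply_symm_apply]
  have hgρ : ∀ a, (e.symm (g a)).1 = ρ a := by
    intro a
    change (e.symm (e _)).1 = _
    rw [e.symm_apply_apply]
  let τ : V → W := fun v => g (σ' v)
  have hτS : ∀ a : S.verts, τ a.1 = g a := fun a => by simp only [τ, hσ']
  have hr : ∀ v, (fib N.graph τ).Reachable v (e.symm (τ v)).1.1 := by
    intro v
    have h1 : (fib N.graph τ).Reachable v (σ v) :=
      fib_mono_reach id (fun a b hab hf => ⟨hab, by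
        have : σ' a = σ' b := Subtype.ext hf
        simp only [τ, id, this]⟩) (hσ3 v)
    have h2 : (fib N.graph τ).Reachable (σ' v).1 (ρ (σ' v)).1 :=
      fib_mono_reach Subtype.val (fun a b hab hf => ⟨S.adj_sub hab, by
        rw [hτS, hτS]
        simp only [g, hf]⟩) (hρ3 (σ' v))
    have h3 : (e.symm (τ v)).1 = ρ (σ' v) := hgρ _
    rw [h3]
    exact h1.trans h2
  refine ⟨τ, ?_, ?_, ?_, ?_⟩
  · intro w
    exact ⟨(e.symm w).1.1, by rw [hτS, hg]⟩
  · intro u v huv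
    have h1 := hr u
    rw [huv] at h1
    exact h1.trans (hr v).symm
  · intro w w' hww
    have key : ∀ w w', w ≠ w' → (∃ p : S.coe.Walk (e.symm w).1 (e.symm w').1, p.IsPath ∧
        ∀ x ∈ p.support, x = (e.symm w).1 ∨ x = (e.symm w').1 ∨
          (S.coe.neighborSet x).ncard = 2) →
        ∃ u v, N.graph.Adj u v ∧ τ u = w ∧ τ v = w' := by
      rintro w w' hne ⟨p, hp, hpd⟩
      obtain ⟨u, v, huv, hu, hv⟩ := smooth_edge S.coe ρ hρ2 hρ1 hρ3 _ _
        (fun h => hne (e.symm.injective (Subtype.ext h))) (e.symm w).2 (e.symm w').2 p hp hpd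
      have hh : ∀ a w, ρ a = (e.symm w).1 → g a = w := by
        intro a w h
        rw [← hgρ] at h
        exact e.symm.injective (Subtype.ext h)
      exact ⟨u.1, v.1, S.adj_sub huv, by rw [hτS]; exact hh _ _ hu, by rw [hτS]; exact hh _ _ hv⟩
    have hadj : (Smoothing S.coe).Adj (e.symm w) (e.symm w') := e.symm.map_rel_iff.2 hww
    have hadj := (fromRel_adj _ _ _).1 hadj
    rcases hadj.2 with h | h
    · exact key w w' hww.ne h
    · obtain ⟨u, v, h1, h2, h3⟩ := key w' w hww.ne' h
      exact ⟨v, u, h1.symm, h3, h2⟩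
  · intro x
    rw [← he x, hτS, hg]

theorem display_self_deg {V X : Type*} (T : PhyloTree V X) (hX : 3 ≤ Nat.card X)
    (z : DisplayVertex T.leaf T.leaf) :
    ∃ a b, a ≠ b ∧ (displayGraph T.graph T.leaf T.graph T.leaf).Adj z a ∧
      (displayGraph T.graph T.leaf T.graph T.leaf).Adj z b := by
  classical
  have hfin := T.finite
  have hl : ∀ u v, toDisplay T.leaf T.leaf (Sum.inl u) = toDisplay T.leaf T.leaf (Sum.inl v) →
      u = v := by
    intro u v h
    rcases (toDisplay_eq_iff_inl T.leaf T.leaf T.leaf_inj _ _).1 h with h | ⟨x, _, h⟩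
    · exact Sum.inl.inj h
    · simp at h
  have hr : ∀ u v, toDisplay T.leaf T.leaf (Sum.inr u) = toDisplay T.leaf T.leaf (Sum.inr v) →
      u = v := by
    intro u v h
    by_cases hv : ∃ x, T.leaf x = v
    · obtain ⟨x, rfl⟩ := hv
      rw [toDisplay_inr_leaf T.leaf T.leaf T.leaf_inj x] at h
      rcases (toDisplay_eq_iff_inl T.leaf T.leaf T.leaf_inj _ _).1 h with h | ⟨x', h1, h⟩
      · simp at h
      · rw [← h1]; exact Sum.inr.inj h
    · exact Sum.inr.inj ((toDisplay_eq_iff_inr T.leaf T.leaf v hv _).1 h)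
  have hlr : ∀ u v, toDisplay T.leaf T.leaf (Sum.inr v) = toDisplay T.leaf T.leaf (Sum.inl u) →
      ∃ x, T.leaf x = u := by
    intro u v h
    rcases (toDisplay_eq_iff_inl T.leaf T.leaf T.leaf_inj _ _).1 h with h | ⟨x, h, _⟩
    · simp at h
    · exact ⟨x, h⟩
  have al : ∀ u v, T.graph.Adj u v → (displayGraph T.graph T.leaf T.graph T.leaf).Adj
      (toDisplay T.leaf T.leaf (Sum.inl u)) (toDisplay T.leaf T.leaf (Sum.inl v)) := by
    intro u v huv
    rw [displayGraph, fromRel_adj]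
    exact ⟨fun h => huv.ne (hl _ _ h), Or.inl (Or.inl ⟨u, v, huv, rfl, rfl⟩)⟩
  have ar : ∀ u v, T.graph.Adj u v → (displayGraph T.graph T.leaf T.graph T.leaf).Adj
      (toDisplay T.leaf T.leaf (Sum.inr u)) (toDisplay T.leaf T.leaf (Sum.inr v)) := by
    intro u v huv
    rw [displayGraph, fromRel_adj]
    exact ⟨fun h => huv.ne (hr _ _ h), Or.inl (Or.inr ⟨u, v, huv, rfl, rfl⟩)⟩
  have two : ∀ v, (∀ x, T.leaf x ≠ v) → ∃ a b, a ≠ b ∧ T.graph.Adj v a ∧ T.graph.Adj v b := by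
    intro v hv
    have h3 := T.internal_deg v hv
    obtain ⟨a, ha, b, hb, hab⟩ := (Set.one_lt_ncard (Set.toFinite _)).1
      (show 1 < (T.graph.neighborSet v).ncard by omega)
    exact ⟨a, b, hab, ha, hb⟩
  rcases toDisplay_cases T.leaf T.leaf z with ⟨v, rfl⟩ | ⟨w, hw, rfl⟩
  · by_cases hv : ∃ x, T.leaf x = v
    · obtain ⟨x, rfl⟩ := hv
      obtain ⟨n, hn⟩ := Set.ncard_eq_one.1 (T.leaf_deg x)
      have hxn : T.graph.Adj (T.leaf x) n := by
        have : n ∈ T.graph.neighborSet (T.leaf x) := by rw [hn]; rfl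
        exact this
      refine ⟨toDisplay T.leaf T.leaf (Sum.inl n), toDisplay T.leaf T.leaf (Sum.inr n), ?_,
        al _ _ hxn, ?_⟩
      · intro h
        obtain ⟨y, rfl⟩ := hlr _ _ h.symm
        obtain ⟨m, hm⟩ := Set.ncard_eq_one.1 (T.leaf_deg y)
        have hmx : m = T.leaf x := by
          have : T.leaf x ∈ T.graph.neighborSet (T.leaf y) := hxn.symm
          rw [hm] at this
          exact this.symm
        have hall : ∀ z, z = x ∨ z = y := by
          intro z
          by_contra hc
          obtain ⟨w⟩ := T.connected.preconnected (T.leaf x) (T.leaf z)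
          obtain ⟨d, -, hd1, hd2⟩ := w.exists_boundary_dart {T.leaf x, T.leaf y} (Or.inl rfl) (by
            rintro (h | h)
            · exact hc (Or.inl (T.leaf_inj h))
            · exact hc (Or.inr (T.leaf_inj h)))
          have hd := d.adj
          rcases hd1 with h | h
          · have : d.snd ∈ T.graph.neighborSet (T.leaf x) := by rw [← h]; exact hd
            rw [hn] at this
            exact hd2 (Or.inr this)
          · have : d.snd ∈ T.graph.neighborSet (T.leaf y) := by
              rw [← Set.mem_singleton_iff.1 h]; exact hd
            rw [hm, hmx] at this
            exact hd2 (Or.inl this)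
        have huniv : (Set.univ : Set X) ⊆ {x, y} := fun z _ => hall z
        have h1 := Set.ncard_le_ncard huniv (Set.toFinite _)
        rw [Set.ncard_univ] at h1
        have h2 := Set.ncard_insert_le x {y}
        rw [Set.ncard_singleton] at h2
        omega
      · rw [← toDisplay_inr_leaf T.leaf T.leaf T.leaf_inj x]
        exact ar _ _ hxn
    · obtain ⟨a, b, hab, ha, hb⟩ := two v (fun x hx => hv ⟨x, hx⟩)
      exact ⟨_, _, fun h => hab (hl _ _ h), al _ _ ha, al _ _ hb⟩
  · obtain ⟨a, b, hab, ha, hb⟩ := two w (fun x hx => hw ⟨x, hx⟩)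
    exact ⟨_, _, fun h => hab (hr _ _ h), ar _ _ ha, ar _ _ hb⟩

/-- If an unrooted binary phylogenetic network `N` displays an unrooted binary
phylogenetic tree `T` on the same label set `X` with `|X| ≥ 3`, then
`tw(D(N,T)) ≤ r(N) + 2`.  Moreover this bound is sharp: for `N = T` one has
`r(N) = 0` and `tw(D(N,T)) = 2`. -/
theorem treewidth_display_le_retic {V W X : Type*}
    (N : PhyloGraph V X) (T : PhyloTree W X) (hX : 3 ≤ Nat.card X)
    (hdisp : Displays N T) :
    treewidth (displayGraph N.graph N.leaf T.graph T.leaf) ≤ reticNumber N + 2 ∧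
    (∀ (V' X' : Type) (T' : PhyloTree V' X'), 3 ≤ Nat.card X' →
      reticNumber T'.toPhyloGraph = 0 ∧
      treewidth (displayGraph T'.graph T'.leaf T'.graph T'.leaf) = 2) := by
  classical
  have hVf := N.finite
  have hWf := T.finite
  constructor
  · obtain ⟨τ, h1, h2, h3, h4⟩ := displays_map N T hdisp
    exact Nat.sInf_le (core_td N.graph T.graph N.leaf T.leaf N.leaf_inj T.leaf_inj
      ⟨T.connected, T.acyclic⟩ τ h1 h2 h3 h4)
  · intro V' X' T' hX'
    have hf := T'.finite
    have htree : T'.graph.IsTree := ⟨T'.connected, T'.acyclic⟩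
    have hret : T'.graph.edgeSet.ncard - (Nat.card V' - 1) = 0 := by
      have h1 := (isTree_iff_connected_and_card.1 htree).2
      have h2 : T'.graph.edgeSet.ncard = Nat.card T'.graph.edgeSet := rfl
      omega
    refine ⟨hret, ?_⟩
    have htd := core_td T'.graph T'.graph T'.leaf T'.leaf T'.leaf_inj T'.leaf_inj htree id
      Function.surjective_id (fun u v huv => by
        have : u = v := huv
        rw [this]) (fun w w' h => ⟨w, w', h, rfl, rfl⟩) (fun _ => rfl)
    rw [hret] at htd
    have hfin : Finite (DisplayVertex T'.leaf T'.leaf) := Subtype.finite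
    have hne : Nonempty (DisplayVertex T'.leaf T'.leaf) :=
      T'.connected.nonempty.map (fun v => toDisplay T'.leaf T'.leaf (Sum.inl v))
    apply le_antisymm
    · exact Nat.sInf_le htd
    · exact no_td_one _ (display_self_deg T' hX') _
        (Nat.sInf_mem (s := {k | HasTreeDecompWidthLE
          (displayGraph T'.graph T'.leaf T'.graph T'.leaf) k}) ⟨_, htd⟩)
end
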